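/- arXiv:1308.5272 — 2 statements merged into one kernel-verified Lean document; each statement's English description precedes it below -/
import Mathlib

section
/- Suppose the SPLC market M satisfies no production out of nothing. Let R = {(y*, z*) + δ·(y∘, z∘) : δ ≥ 0} be a set all of whose points are solutions of NHAD-LCP', with z* > 0 and direction (y∘, z∘) ≠ 0 (necessarily (y∘, z∘) ≥ 0). If y∘ = 0 (so z∘ > 0), then y* = 0; that is, R is the primary ray, on which all variables except z are zero. -/
open scoped Classical

noncomputable section

/-- An SPLC market: finitely many goods `G`, agents `A`, and firms `F`;
endowments `w`, firm ownership shares `θ`, firm `f` produces good `jf f`;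
agent `i`'s utility for good `j` is SPLC with `numU i j` segments of slopes `u i j k`
and lengths `l i j k` (`k < numU i j`); firm `f`'s production of good `jf f` from
raw good `j` is SPLC with `numP f j` segments of slopes `α f j k` and lengths `o f j k`. -/
structure SPLCMarket where
  (G A F : Type)
  [instG : Fintype G]
  [instA : Fintype A]
  [instF : Fintype F]
  (w : A → G → ℝ)
  (w_nonneg : ∀ i j, 0 ≤ w i j)
  (w_sum : ∀ j, ∑ i, w i j = 1)
  (jf : F → G)
  (θ : A → F → ℝ)
  (θ_nonneg : ∀ i f, 0 ≤ θ i f)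
  (θ_sum : ∀ f, ∑ i, θ i f = 1)
  (numU : A → G → ℕ)
  (numU_pos : ∀ i j, 0 < numU i j)
  (u : A → G → ℕ → ℝ)
  (l : A → G → ℕ → ℝ)
  (u_nonneg : ∀ i j k, k < numU i j → 0 ≤ u i j k)
  (l_pos : ∀ i j k, k < numU i j → 0 < l i j k)
  (u_anti : ∀ i j k, k + 1 < numU i j → u i j (k + 1) < u i j k)
  (numP : F → G → ℕ)
  (numP_pos : ∀ f j, 0 < numP f j)
  (α : F → G → ℕ → ℝ)
  (o : F → G → ℕ → ℝ)
  (α_nonneg : ∀ f j k, k < numP f j → 0 ≤ α f j k)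
  (o_pos : ∀ f j k, k < numP f j → 0 < o f j k)
  (α_anti : ∀ f j k, k + 1 < numP f j → α f j (k + 1) < α f j k)

attribute [instance] SPLCMarket.instG SPLCMarket.instA SPLCMarket.instF

namespace SPLCMarket

variable (M : SPLCMarket)

/-- A segment-indexed allocation: nonnegative, within segment lengths, zero beyond
the actual segments. -/
def IsSegAlloc (num : M.G → ℕ) (len : M.G → ℕ → ℝ) (x : M.G → ℕ → ℝ) : Prop :=
  ∀ j k, 0 ≤ x j k ∧ (k < num j → x j k ≤ len j k) ∧ (num j ≤ k → x j k = 0)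

/-- A production plan of firm `f`: amounts of raw goods used on each segment. -/
def IsPlan (f : M.F) (x : M.G → ℕ → ℝ) : Prop :=
  M.IsSegAlloc (M.numP f) (M.o f) x

/-- Profit of plan `x` of firm `f` at prices `p`. -/
def planProfit (f : M.F) (p : M.G → ℝ) (x : M.G → ℕ → ℝ) : ℝ :=
  ∑ j, ∑ k ∈ Finset.range (M.numP f j), x j k * (M.α f j k * p (M.jf f) - p j)

/-- Amount of good `jf f` produced by plan `x` of firm `f`. -/
def planOutput (f : M.F) (x : M.G → ℕ → ℝ) : ℝ :=
  ∑ j, ∑ k ∈ Finset.range (M.numP f j), M.α f j k * x j k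

/-- A profit-maximizing production plan. -/
def OptimalPlan (f : M.F) (p : M.G → ℝ) (x : M.G → ℕ → ℝ) : Prop :=
  M.IsPlan f x ∧ ∀ x', M.IsPlan f x' → M.planProfit f p x' ≤ M.planProfit f p x

/-- Amount allocated to segment `k` when an amount `t` is filled greedily along
segments of lengths `len 0, len 1, …`. -/
def segAmt (len : ℕ → ℝ) (k : ℕ) (t : ℝ) : ℝ :=
  max 0 (min (len k) (t - ∑ k' ∈ Finset.range k, len k'))

/-- The (separable piecewise-linear concave) utility of agent `i` for bundle `x`. -/
def utilFn (i : M.A) (x : M.G → ℝ) : ℝ :=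
  ∑ j, ∑ k ∈ Finset.range (M.numU i j), M.u i j k * segAmt (M.l i j) k (x j)

/-- Utility of a segment-indexed allocation of agent `i`. -/
def segUtility (i : M.A) (x : M.G → ℕ → ℝ) : ℝ :=
  ∑ j, ∑ k ∈ Finset.range (M.numU i j), M.u i j k * x j k

/-- Cost of bundle `x` at prices `p`. -/
def bundleCost (p : M.G → ℝ) (x : M.G → ℝ) : ℝ := ∑ j, p j * x j

/-- `x` is an optimal (budget-constrained utility-maximizing) bundle for agent `i`. -/
def OptimalBundleAmt (i : M.A) (p : M.G → ℝ) (B : ℝ) (x : M.G → ℝ) : Prop :=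
  (∀ j, 0 ≤ x j) ∧ M.bundleCost p x ≤ B ∧
    ∀ y : M.G → ℝ, (∀ j, 0 ≤ y j) → M.bundleCost p y ≤ B → M.utilFn i y ≤ M.utilFn i x

/-- A segment-indexed optimal bundle for agent `i`: affordable, and its utility is at
least that of any affordable bundle. -/
def OptimalBundle (i : M.A) (p : M.G → ℝ) (B : ℝ) (x : M.G → ℕ → ℝ) : Prop :=
  M.IsSegAlloc (M.numU i) (M.l i) x ∧
  M.bundleCost p (fun j => ∑ k ∈ Finset.range (M.numU i j), x j k) ≤ B ∧
  ∀ y : M.G → ℝ, (∀ j, 0 ≤ y j) → M.bundleCost p y ≤ B → M.utilFn i y ≤ M.segUtility i x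

/-- Budget of agent `i` at prices `p` when firms' (maximum) profits are `E`. -/
def budget (i : M.A) (p : M.G → ℝ) (E : M.F → ℝ) : ℝ :=
  ∑ j, M.w i j * p j + ∑ f, M.θ i f * E f

/-- Market equilibrium: nonnegative prices, profit-maximizing plans (with `E f` the
maximum profit of firm `f`), optimal bundles, and market clearing for every good. -/
def IsEquilibrium (p : M.G → ℝ) (xF : M.F → M.G → ℕ → ℝ) (xA : M.A → M.G → ℕ → ℝ)
    (E : M.F → ℝ) : Prop :=
  (∀ j, 0 ≤ p j) ∧
  (∀ f, M.OptimalPlan f p (xF f) ∧ E f = M.planProfit f p (xF f)) ∧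
  (∀ i, M.OptimalBundle i p (M.budget i p E) (xA i)) ∧
  (∀ j, (∑ i, ∑ k ∈ Finset.range (M.numU i j), xA i j k)
      + (∑ f, ∑ k ∈ Finset.range (M.numP f j), xF f j k)
      = 1 + ∑ f, if M.jf f = j then M.planOutput f (xF f) else 0)

/-- No production out of nothing: along every cyclic sequence of (first segments of)
productions, the rates multiply to strictly less than `1`. -/
def NoProductionOutOfNothing : Prop :=
  ∀ (m : ℕ) (fs : Fin (m + 1) → M.F) (gs : Fin (m + 1) → M.G),
    (∀ t, 0 < M.α (fs t) (gs t) 0) → (∀ t, M.jf (fs t) = gs (t + 1)) →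
    ∏ t, M.α (fs t) (gs t) 0 < 1

/-- Total amount of good `j` represented by agents' segments with positive slope. -/
def desire (j : M.G) : ℝ :=
  ∑ i, ∑ k ∈ (Finset.range (M.numU i j)).filter (fun k => 0 < M.u i j k), M.l i j k

def EnoughDemand : Prop := ∀ j, 1 < M.desire j

/-- A node (agent or firm) possesses/produces good `j`. -/
def owns : M.A ⊕ M.F → M.G → Prop
  | Sum.inl i, j => 0 < M.w i j
  | Sum.inr f, j => M.jf f = j

/-- A node (agent or firm) is non-satiated by good `j`: its last segment for `j`
has positive slope. -/
def nonsat : M.A ⊕ M.F → M.G → Prop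
  | Sum.inl i, j => 0 < M.u i j (M.numU i j - 1)
  | Sum.inr f, j => 0 < M.α f j (M.numP f j - 1)

/-- Edge of the graph `G(M)`. -/
def edge (a b : M.A ⊕ M.F) : Prop := ∃ j, M.owns a j ∧ M.nonsat b j

/-- Strong connectivity: all agent nodes lie in one strongly connected component of `G(M)`. -/
def StrongConnectivity : Prop :=
  ∀ i i' : M.A, Relation.ReflTransGen M.edge (Sum.inl i) (Sum.inl i')

/-- The largest production slope (or `0`). -/
def αmax : ℝ := sSup (insert 0 {x | ∃ f j k, k < M.numP f j ∧ M.α f j k = x})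

/-- The smallest positive production slope. -/
def αminpos : ℝ := sInf {x | 0 < x ∧ ∃ f j k, k < M.numP f j ∧ M.α f j k = x}

/-- The safe bound `L = n^n (α_max + 1)^n`. -/
def Lbig : ℝ :=
  (Fintype.card M.G : ℝ) ^ (Fintype.card M.G) * (M.αmax + 1) ^ (Fintype.card M.G)

/-- Lengths of last segments are fixed to the safe values. -/
def SafeLengths : Prop :=
  (∀ f j, M.o f j (M.numP f j - 1) = M.Lbig / max 1 M.αminpos) ∧
  (∀ i j, M.l i j (M.numU i j - 1) = M.Lbig + 1)

/-- Revenue from production of good `j`: `∑_{f : jf f = j} ∑_{j',k} s^f_{j'k}`,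
where `s^f_{jk} = r^f_{jk} + o^f_{jk} β^f_{jk}`. -/
def prodRevenue (r β : M.F → M.G → ℕ → ℝ) (j : M.G) : ℝ :=
  ∑ f, if M.jf f = j then
      ∑ j', ∑ k ∈ Finset.range (M.numP f j'), (r f j' k + M.o f j' k * β f j' k)
    else 0

/-- The profit `E^f = ∑_{j,k} o^f_{jk} β^f_{jk}` of firm `f` in the LCP. -/
def lcpProfit (β : M.F → M.G → ℕ → ℝ) (f : M.F) : ℝ :=
  ∑ j, ∑ k ∈ Finset.range (M.numP f j), M.o f j k * β f j k

/-- The common core of AD-LCP, NHAD-LCP and NHAD-LCP': all constraints and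
complementarity conditions, with prices `p`, good-clearing complementarity multiplier
`pc`, and `zsub` subtracted in the agents' constraints. -/
def LCPCore (lam : M.A → ℝ) (p pc : M.G → ℝ) (q γ : M.A → M.G → ℕ → ℝ)
    (r β : M.F → M.G → ℕ → ℝ) (zsub : ℝ) : Prop :=
  (∀ i, 0 ≤ lam i) ∧
  (∀ i j k, 0 ≤ q i j k ∧ 0 ≤ γ i j k ∧ (M.numU i j ≤ k → q i j k = 0 ∧ γ i j k = 0)) ∧
  (∀ f j k, 0 ≤ r f j k ∧ 0 ≤ β f j k ∧ (M.numP f j ≤ k → r f j k = 0 ∧ β f j k = 0)) ∧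
  (∀ f j k, k < M.numP f j →
    M.α f j k * p (M.jf f) - p j ≤ β f j k ∧
    r f j k * (M.α f j k * p (M.jf f) - p j - β f j k) = 0) ∧
  (∀ f j k, k < M.numP f j →
    r f j k ≤ M.o f j k * p j ∧ β f j k * (r f j k - M.o f j k * p j) = 0) ∧
  (∀ j, (∑ i, ∑ k ∈ Finset.range (M.numU i j), q i j k)
      + (∑ f, ∑ k ∈ Finset.range (M.numP f j), r f j k)
      ≤ p j + M.prodRevenue r β j ∧
    pc j * ((∑ i, ∑ k ∈ Finset.range (M.numU i j), q i j k)
      + (∑ f, ∑ k ∈ Finset.range (M.numP f j), r f j k)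
      - p j - M.prodRevenue r β j) = 0) ∧
  (∀ i, (∑ j, M.w i j * p j) + (∑ f, M.θ i f * M.lcpProfit β f)
      - (∑ j, ∑ k ∈ Finset.range (M.numU i j), q i j k) - zsub ≤ 0 ∧
    lam i * ((∑ j, M.w i j * p j) + (∑ f, M.θ i f * M.lcpProfit β f)
      - (∑ j, ∑ k ∈ Finset.range (M.numU i j), q i j k) - zsub) = 0) ∧
  (∀ i j k, k < M.numU i j →
    M.u i j k * lam i ≤ p j + γ i j k ∧
    q i j k * (M.u i j k * lam i - p j - γ i j k) = 0) ∧
  (∀ i j k, k < M.numU i j →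
    q i j k ≤ M.l i j k * p j ∧ γ i j k * (q i j k - M.l i j k * p j) = 0)

/-- AD-LCP. -/
def ADLCP (lam : M.A → ℝ) (p : M.G → ℝ) (q γ : M.A → M.G → ℕ → ℝ)
    (r β : M.F → M.G → ℕ → ℝ) : Prop :=
  (∀ j, 0 ≤ p j) ∧ M.LCPCore lam p p q γ r β 0

/-- The vector `c` of price lower bounds: `c j > 1` and no segment has positive
profit at prices `c`. -/
def GoodPriceLB (c : M.G → ℝ) : Prop :=
  (∀ j, 1 < c j) ∧ ∀ f j k, k < M.numP f j → M.α f j k * c (M.jf f) < c j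

/-- NHAD-LCP: AD-LCP with `p j = p' j + c j`, the good-clearing complementarity
multiplier being `p'`. -/
def NHADLCP (c : M.G → ℝ) (lam : M.A → ℝ) (p' : M.G → ℝ) (q γ : M.A → M.G → ℕ → ℝ)
    (r β : M.F → M.G → ℕ → ℝ) : Prop :=
  (∀ j, 0 ≤ p' j) ∧ M.LCPCore lam (fun j => p' j + c j) p' q γ r β 0

/-- NHAD-LCP': NHAD-LCP augmented with the variable `z` in the agents' constraints. -/
def NHADLCP' (c : M.G → ℝ) (lam : M.A → ℝ) (p' : M.G → ℝ) (q γ : M.A → M.G → ℕ → ℝ)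
    (r β : M.F → M.G → ℕ → ℝ) (z : ℝ) : Prop :=
  (∀ j, 0 ≤ p' j) ∧ 0 ≤ z ∧ M.LCPCore lam (fun j => p' j + c j) p' q γ r β z

end SPLCMarket

theorem Finite.exists_cycle {β : Type*} [Finite β] [Nonempty β] (next : β → β) :
    ∃ (m : ℕ) (g : Fin (m + 1) → β), ∀ t, next (g t) = g (t + 1) := by
  obtain ⟨x⟩ := ‹Nonempty β›
  obtain ⟨a, b, hab, heq⟩ :=
    Finite.exists_ne_map_eq_of_infinite (fun n : ℕ => next^[n] x)
  wlog hlt : a < b generalizing a b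
  · exact this b a hab.symm heq.symm (by omega)
  obtain ⟨m, rfl⟩ : ∃ m, b = m + 1 + a := ⟨b - a - 1, by omega⟩
  refine ⟨m, fun t => next^[t] (next^[a] x), fun t => ?_⟩
  beta_reduce
  rw [← Function.iterate_succ_apply' next]
  rcases eq_or_ne t (Fin.last m) with rfl | ht
  · rw [Fin.last_add_one, Fin.val_zero, Fin.val_last, ← Function.iterate_add_apply]
    exact heq.symm
  · rw [Fin.val_add_one_of_lt (Fin.lt_last_iff_ne_last.2 ht)]

namespace SPLCMarket

theorem α_le_α_zero (M : SPLCMarket) (f : M.F) (j : M.G) {k : ℕ} (hk : k < M.numP f j) :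
    M.α f j k ≤ M.α f j 0 := by
  induction k with
  | zero => exact le_rfl
  | succ k ih => exact (M.α_anti f j k hk).le.trans (ih (by omega))

/-- Without production out of nothing, at positive prices every nonempty set of goods has a
member from which no good of the set can be produced without a loss. -/
theorem NoProductionOutOfNothing.exists_unprofitable {M : SPLCMarket}
    (hnp : M.NoProductionOutOfNothing) {p : M.G → ℝ} (hp : ∀ j, 0 < p j) {S : Set M.G}
    (hS : S.Nonempty) :
    ∃ j ∈ S, ∀ f, M.jf f ∈ S → M.α f j 0 * p (M.jf f) < p j := by
  by_contra! h
  choose firm hmem hle using fun j : S => h j j.2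
  have := hS.to_subtype
  obtain ⟨m, g, hg⟩ :=
    Finite.exists_cycle (fun j : S => (⟨M.jf (firm j), hmem j⟩ : S))
  have hnext : ∀ t, M.jf (firm (g t)) = g (t + 1) := fun t => congrArg Subtype.val (hg t)
  have hstep : ∀ t, p (g t) ≤ M.α (firm (g t)) (g t) 0 * p (g (t + 1)) := fun t => by
    simpa only [hnext] using hle (g t)
  have hlt := hnp m (fun t => firm (g t)) (fun t => g t)
    (fun t => pos_of_mul_pos_left ((hp _).trans_le (hstep t)) (hp _).le) hnext
  have hprod := Finset.prod_le_prod (s := Finset.univ) (fun t _ => (hp (g t)).le)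
    (fun t _ => hstep t)
  rw [Finset.prod_mul_distrib,
    show ∏ t, p (g (t + 1)) = ∏ t, p (g t) from
      Equiv.prod_comp (Equiv.addRight 1) fun t => p (g t)] at hprod
  have hpos : 0 < ∏ t, p (g t) := Finset.prod_pos fun t _ => hp _
  nlinarith

theorem prodRevenue_nonneg (M : SPLCMarket) {r β : M.F → M.G → ℕ → ℝ}
    (hr : ∀ f j k, 0 ≤ r f j k) (hβ : ∀ f j k, 0 ≤ β f j k) (j : M.G) :
    0 ≤ M.prodRevenue r β j := by
  refine Finset.sum_nonneg fun f _ => ?_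
  split_ifs
  · exact Finset.sum_nonneg fun j' _ => Finset.sum_nonneg fun k hk =>
      add_nonneg (hr f j' k)
        (mul_nonneg (M.o_pos f j' k (Finset.mem_range.1 hk)).le (hβ f j' k))
  · exact le_rfl

/-- The only solution of NHAD-LCP' in which the multipliers `λ` vanish is the trivial one. -/
theorem NHADLCP'.eq_zero_of_lam_eq_zero {M : SPLCMarket} (hnp : M.NoProductionOutOfNothing)
    {c : M.G → ℝ} (hc : M.GoodPriceLB c) {p' : M.G → ℝ} {q γ : M.A → M.G → ℕ → ℝ}
    {r β : M.F → M.G → ℕ → ℝ} {z : ℝ} (h : M.NHADLCP' c 0 p' q γ r β z) :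
    p' = 0 ∧ q = 0 ∧ γ = 0 ∧ r = 0 ∧ β = 0 := by
  obtain ⟨hp', -, -, hqγ, hrβ, hprofit, hcap, hgood, -, hutil, hlen⟩ := h
  have hp : ∀ j, 0 < p' j + c j := fun j => by linarith [hp' j, hc.1 j]
  have hq0 : ∀ i j k, q i j k = 0 := fun i j k => by
    rcases lt_or_ge k (M.numU i j) with hk | hk
    · refine (mul_eq_zero.1 (hutil i j k hk).2).resolve_right (ne_of_lt ?_)
      simp only [Pi.zero_apply, mul_zero]
      linarith [hp j, (hqγ i j k).2.1]
    · exact ((hqγ i j k).2.2 hk).1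
  have hγ0 : ∀ i j k, γ i j k = 0 := fun i j k => by
    rcases lt_or_ge k (M.numU i j) with hk | hk
    · refine (mul_eq_zero.1 (hlen i j k hk).2).resolve_right (ne_of_lt ?_)
      rw [hq0]
      linarith [mul_pos (M.l_pos i j k hk) (hp j)]
    · exact ((hqγ i j k).2.2 hk).2
  have hinput : ∀ j, 0 < p' j → ∃ f, ∃ k < M.numP f j, 0 < r f j k := fun j hj => by
    by_contra! hle
    have hclear := (mul_eq_zero.1 (hgood j).2).resolve_left hj.ne'
    have hrsum : ∑ f, ∑ k ∈ Finset.range (M.numP f j), r f j k ≤ 0 :=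
      Finset.sum_nonpos fun f _ => Finset.sum_nonpos fun k hk =>
        hle f k (Finset.mem_range.1 hk)
    simp only [hq0, Finset.sum_const_zero] at hclear
    linarith [hp j, M.prodRevenue_nonneg (fun f j k => (hrβ f j k).1)
      (fun f j k => (hrβ f j k).2.1) j]
  have hp'0 : ∀ j, p' j = 0 := by
    by_contra! hne
    obtain ⟨j₀, hj₀⟩ := hne
    obtain ⟨j, hj, hloss⟩ := hnp.exists_unprofitable hp (S := {j | 0 < p' j})
      ⟨j₀, lt_of_le_of_ne (hp' j₀) hj₀.symm⟩
    obtain ⟨f, k, hk, hrpos⟩ := hinput j hj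
    have hzero := (mul_eq_zero.1 (hprofit f j k hk).2).resolve_left hrpos.ne'
    have hβ := (hrβ f j k).2.1
    have hcf := hc.2 f j k hk
    have hjf : 0 < p' (M.jf f) := by
      refine pos_of_mul_pos_right (a := M.α f j k) ?_ (M.α_nonneg f j k hk)
      linarith [show 0 < p' j from hj]
    linarith [hloss f hjf, mul_le_mul_of_nonneg_right (M.α_le_α_zero f j hk) (hp (M.jf f)).le]
  have hr0 : ∀ f j k, r f j k = 0 := fun f j k => by
    rcases lt_or_ge k (M.numP f j) with hk | hk
    · refine (mul_eq_zero.1 (hprofit f j k hk).2).resolve_right (ne_of_lt ?_)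
      simp only [hp'0, zero_add]
      linarith [hc.2 f j k hk, (hrβ f j k).2.1]
    · exact ((hrβ f j k).2.2 hk).1
  have hβ0 : ∀ f j k, β f j k = 0 := fun f j k => by
    rcases lt_or_ge k (M.numP f j) with hk | hk
    · refine (mul_eq_zero.1 (hcap f j k hk).2).resolve_right (ne_of_lt ?_)
      rw [hr0]
      linarith [mul_pos (M.o_pos f j k hk) (hp j)]
    · exact ((hrβ f j k).2.2 hk).2
  exact ⟨funext hp'0, by ext; apply hq0, by ext; apply hγ0, by ext; apply hr0,
    by ext; apply hβ0⟩

/-- If `z` can be changed with all other variables fixed, then the multipliers `λ` vanish. -/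
theorem NHADLCP'.lam_eq_zero {M : SPLCMarket} {c : M.G → ℝ} {lam : M.A → ℝ}
    {p' : M.G → ℝ} {q γ : M.A → M.G → ℕ → ℝ} {r β : M.F → M.G → ℕ → ℝ} {z z' : ℝ}
    (h : M.NHADLCP' c lam p' q γ r β z) (h' : M.NHADLCP' c lam p' q γ r β z')
    (hz : z ≠ z') : lam = 0 := by
  obtain ⟨-, -, -, -, -, -, -, -, hbudget, -, -⟩ := h
  obtain ⟨-, -, -, -, -, -, -, -, hbudget', -, -⟩ := h'
  ext i
  exact (mul_eq_zero.1 (show lam i * (z - z') = 0 by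
    linarith [(hbudget i).2, (hbudget' i).2])).resolve_right (sub_ne_zero.2 hz)

end SPLCMarket

/-- Suppose the SPLC market `M` satisfies no production out of nothing. Let
`R = {(y*, z*) + δ (y∘, z∘) : δ ≥ 0}` be a ray all of whose points are solutions of
NHAD-LCP', with `z* > 0` and direction `(y∘, z∘) ≠ 0`. If `y∘ = 0` then `y* = 0`, i.e.,
`R` is the primary ray, on which all variables except `z` are zero. -/
theorem stmt13 (M : SPLCMarket) (hnp : M.NoProductionOutOfNothing)
    (c : M.G → ℝ) (hc : M.GoodPriceLB c)
    (lams : M.A → ℝ) (p's : M.G → ℝ) (qs γs : M.A → M.G → ℕ → ℝ)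
    (rs βs : M.F → M.G → ℕ → ℝ) (zs : ℝ)
    (lamd : M.A → ℝ) (p'd : M.G → ℝ) (qd γd : M.A → M.G → ℕ → ℝ)
    (rd βd : M.F → M.G → ℕ → ℝ) (zd : ℝ)
    (hzs : 0 < zs)
    (hdir : ¬(lamd = 0 ∧ p'd = 0 ∧ qd = 0 ∧ γd = 0 ∧ rd = 0 ∧ βd = 0 ∧ zd = 0))
    (hray : ∀ δ : ℝ, 0 ≤ δ →
      M.NHADLCP' c (fun i => lams i + δ * lamd i) (fun j => p's j + δ * p'd j)
        (fun i j k => qs i j k + δ * qd i j k) (fun i j k => γs i j k + δ * γd i j k)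
        (fun f j k => rs f j k + δ * rd f j k) (fun f j k => βs f j k + δ * βd f j k)
        (zs + δ * zd))
    (hyzero : lamd = 0 ∧ p'd = 0 ∧ qd = 0 ∧ γd = 0 ∧ rd = 0 ∧ βd = 0) :
    lams = 0 ∧ p's = 0 ∧ qs = 0 ∧ γs = 0 ∧ rs = 0 ∧ βs = 0 := by
  obtain ⟨rfl, rfl, rfl, rfl, rfl, rfl⟩ := hyzero
  have hzd : zd ≠ 0 := by simpa using hdir
  have h₀ := hray 0 le_rfl
  have h₁ := hray 1 zero_le_one
  simp only [Pi.zero_apply, mul_zero, zero_mul, one_mul, add_zero] at h₀ h₁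
  obtain rfl : lams = 0 := h₀.lam_eq_zero h₁ (by simpa using hzd)
  exact ⟨rfl, h₀.eq_zero_of_lam_eq_zero hnp hc⟩
end
end

section
/- If an SPLC market M satisfies strong connectivity, no production out of nothing, and enough demand, then M admits a market equilibrium. -/
open scoped Classical

noncomputable section

/-! ### A cubical Sperner lemma -/

/-- A discrete analogue (modulo `2`) of the coefficient along the directions `I` of the form
`dλ_{i₁} ∧ ⋯ ∧ dλ_{iₘ}`, where `l = [i₁, …, iₘ]`, on the integer grid. -/
def gridForm {ι : Type*} (lab : ι → (ι → ℕ) → ZMod 2) : List ι → Finset ι → (ι → ℕ) → ZMod 2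
  | [], _, _ => 1
  | i :: l, I, x => ∑ a ∈ I, (lab i (x + Pi.single a 1) - lab i x) *
      gridForm lab l (I.erase a) (x + Pi.single a 1)

/-- A sum of a symmetric function over ordered pairs of distinct elements is even. -/
theorem sum_sum_erase_symm {ι : Type*} (I : Finset ι) (h : ι → ι → ZMod 2)
    (hs : ∀ a b, h a b = h b a) : ∑ a ∈ I, ∑ b ∈ I.erase a, h a b = 0 := by
  induction I using Finset.induction_on with
  | empty => simp
  | insert c I hc ih =>
    rw [Finset.sum_insert hc, Finset.erase_insert hc]
    have h1 : ∀ a ∈ I, ∑ b ∈ (insert c I).erase a, h a b = h c a + ∑ b ∈ I.erase a, h a b := by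
      intro a ha
      have hne : c ≠ a := fun e => hc (e ▸ ha)
      rw [Finset.erase_insert_of_ne hne, Finset.sum_insert (by simp [hc]), hs a c]
    rw [Finset.sum_congr rfl h1, Finset.sum_add_distrib, ih, add_zero]
    exact CharTwo.add_self_eq_zero _

theorem sum_sum_erase_comm {ι : Type*} (I : Finset ι) (h : ι → ι → ZMod 2) :
    ∑ a ∈ I, ∑ b ∈ I.erase a, h a b = ∑ b ∈ I, ∑ a ∈ I.erase b, h a b := by
  refine Finset.sum_comm' ?_
  intro a b
  simp only [Finset.mem_erase]
  tauto

/-- The discrete form `gridForm` is closed. -/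
theorem gridForm_closed {ι : Type*} (lab : ι → (ι → ℕ) → ZMod 2) (l : List ι) :
    ∀ (I : Finset ι) (x : ι → ℕ), ∑ a ∈ I,
      (gridForm lab l (I.erase a) (x + Pi.single a 1) - gridForm lab l (I.erase a) x) = 0 := by
  induction l with
  | nil => intro I x; simp [gridForm]
  | cons i l ih =>
    intro I x
    have key : ∀ a ∈ I,
        gridForm lab (i :: l) (I.erase a) (x + Pi.single a 1)
          - gridForm lab (i :: l) (I.erase a) x =
        ∑ b ∈ I.erase a,
          (lab i (x + Pi.single a 1 + Pi.single b 1) - lab i (x + Pi.single a 1)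
            - lab i (x + Pi.single b 1) + lab i x) *
              gridForm lab l ((I.erase a).erase b) (x + Pi.single a 1 + Pi.single b 1)
        + ∑ b ∈ I.erase a, (lab i (x + Pi.single b 1) - lab i x) *
            (gridForm lab l ((I.erase b).erase a) (x + Pi.single b 1 + Pi.single a 1)
              - gridForm lab l ((I.erase b).erase a) (x + Pi.single b 1)) := by
      intro a _
      simp only [gridForm]
      rw [← Finset.sum_sub_distrib, ← Finset.sum_add_distrib]
      refine Finset.sum_congr rfl fun b _ => ?_
      rw [Finset.erase_right_comm (a := b) (b := a), add_right_comm x (Pi.single b 1)]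
      ring
    rw [Finset.sum_congr rfl key, Finset.sum_add_distrib, sum_sum_erase_symm, sum_sum_erase_comm,
      zero_add]
    · refine Finset.sum_eq_zero fun b _ => ?_
      rw [← Finset.mul_sum, ih, mul_zero]
    · intro a b
      rw [Finset.erase_right_comm, add_right_comm x (Pi.single b 1)]
      ring

/-- On a hyperplane where one of the labels is constant, `gridForm` vanishes along the directions
of the hyperplane. -/
theorem gridForm_eq_zero {ι : Type*} (lab : ι → (ι → ℕ) → ZMod 2) (a : ι) (v : ℕ) (t : ZMod 2)
    (hlab : ∀ x : ι → ℕ, x a = v → lab a x = t) (l : List ι) (hal : a ∈ l) :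
    ∀ (I : Finset ι) (x : ι → ℕ), a ∉ I → x a = v → gridForm lab l I x = 0 := by
  induction l with
  | nil => simp at hal
  | cons i l ih =>
    intro I x ha hx
    refine Finset.sum_eq_zero fun b hb => ?_
    have hba : b ≠ a := fun e => ha (e ▸ hb)
    have hx' : (x + Pi.single b 1 : ι → ℕ) a = v := by simp [hba.symm, hx]
    by_cases hi : a = i
    · subst hi
      rw [hlab _ hx', hlab _ hx, sub_self, zero_mul]
    · have : a ∈ l := by simpa [hi] using hal
      rw [ih this _ _ (by simp [ha]) hx', mul_zero]

/-- The grid points which agree with `y` off `I` and have coordinates `< N` along `I`. -/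
def gridBox {ι : Type*} [Fintype ι] (N : ℕ) (I : Finset ι) (y : ι → ℕ) : Finset (ι → ℕ) :=
  Fintype.piFinset fun a => if a ∈ I then Finset.range N else {y a}

theorem mem_gridBox {ι : Type*} [Fintype ι] {N : ℕ} {I : Finset ι} {y x : ι → ℕ} :
    x ∈ gridBox N I y ↔ ∀ a, if a ∈ I then x a < N else x a = y a := by
  simp only [gridBox, Fintype.mem_piFinset]
  refine forall_congr' fun a => ?_
  split_ifs <;> simp

theorem sum_gridBox {ι : Type*} [Fintype ι] (N : ℕ) (I : Finset ι) (y : ι → ℕ) {a : ι}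
    (ha : a ∈ I) (g : (ι → ℕ) → ZMod 2) :
    ∑ x ∈ gridBox N I y, g x =
      ∑ x ∈ gridBox N (I.erase a) (Function.update y a 0), ∑ k ∈ Finset.range N,
        g (Function.update x a k) := by
  rw [← Finset.sum_product']
  refine Finset.sum_nbij' (fun x => (Function.update x a 0, x a))
    (fun z => Function.update z.1 a z.2) ?_ ?_ ?_ ?_ ?_
  · intro x hx
    rw [mem_gridBox] at hx
    have := hx a
    simp only [ha, if_true] at this
    simp only [Finset.mem_product, mem_gridBox, Finset.mem_range, this, and_true]
    intro b
    by_cases hb : b = a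
    · subst hb; simp
    · have := hx b
      simpa [hb] using this
  · intro z hz
    simp only [Finset.mem_product, mem_gridBox, Finset.mem_range] at hz
    rw [mem_gridBox]
    intro b
    by_cases hb : b = a
    · subst hb; simp [ha, hz.2]
    · have := hz.1 b
      simpa [hb] using this
  · intro x _; simp
  · intro z hz
    simp only [Finset.mem_product, mem_gridBox, Finset.mem_range] at hz
    have := hz.1 a
    simp at this
    ext b
    · by_cases hb : b = a
      · subst hb; simp [this]
      · simp [hb]
    · simp
  · intro x _; simp

theorem gridBox_update {ι : Type*} [Fintype ι] (N : ℕ) (I : Finset ι) (y : ι → ℕ) (a : ι)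
    (v w : ℕ) (ha : a ∉ I) (g : (ι → ℕ) → ZMod 2) :
    ∑ x ∈ gridBox N I (Function.update y a w), g (Function.update x a v) =
      ∑ x ∈ gridBox N I (Function.update y a v), g x := by
  refine Finset.sum_nbij' (fun x => Function.update x a v) (fun x => Function.update x a w)
    ?_ ?_ ?_ ?_ ?_
  · intro x hx
    rw [mem_gridBox] at hx ⊢
    intro b
    by_cases hb : b = a
    · subst hb; simp [ha]
    · simpa [hb] using hx b
  · intro x hx
    rw [mem_gridBox] at hx ⊢
    intro b
    by_cases hb : b = a
    · subst hb; simp [ha]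
    · simpa [hb] using hx b
  · intro x hx
    rw [mem_gridBox] at hx
    have := hx a
    simp only [ha, if_false, Function.update_self] at this
    simp [← this]
  · intro x hx
    rw [mem_gridBox] at hx
    have := hx a
    simp only [ha, if_false, Function.update_self] at this
    simp [← this]
  · intro x _; rfl

/-- Telescoping a sum of differences over a grid box. -/
theorem sum_gridBox_diff {ι : Type*} [Fintype ι] (N : ℕ) (I : Finset ι) (y : ι → ℕ) {a : ι}
    (ha : a ∈ I) (g : (ι → ℕ) → ZMod 2) :
    ∑ x ∈ gridBox N I y, (g (x + Pi.single a 1) - g x) =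
      ∑ x ∈ gridBox N (I.erase a) (Function.update y a N), g x -
      ∑ x ∈ gridBox N (I.erase a) (Function.update y a 0), g x := by
  rw [sum_gridBox N I y ha]
  have h1 : ∀ (x : ι → ℕ) (k : ℕ),
      Function.update x a k + Pi.single a 1 = Function.update x a (k + 1) := by
    intro x k
    ext b
    by_cases hb : b = a
    · subst hb; simp
    · simp [hb]
  simp only [h1]
  have h2 : ∀ x : ι → ℕ, ∑ k ∈ Finset.range N,
      (g (Function.update x a (k + 1)) - g (Function.update x a k)) =
      g (Function.update x a N) - g (Function.update x a 0) := fun x =>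
    Finset.sum_range_sub (fun k => g (Function.update x a k)) N
  simp only [h2, Finset.sum_sub_distrib]
  rw [gridBox_update _ _ _ _ _ _ (by simp), gridBox_update _ _ _ _ _ _ (by simp)]

theorem sum_gridForm {ι : Type*} [Fintype ι] (N : ℕ) (lab : ι → (ι → ℕ) → ZMod 2)
    (h0 : ∀ i x, x i = 0 → lab i x = 0) (h1 : ∀ i x, x i = N → lab i x = 1) (l : List ι) :
    ∀ y : ι → ℕ, l.Nodup → ∑ x ∈ gridBox N l.toFinset y, gridForm lab l l.toFinset x = 1 := by
  induction l with
  | nil =>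
    intro y _
    have : gridBox N (∅ : Finset ι) y = {y} := by
      ext x; simp [mem_gridBox, funext_iff]
    simp [this, gridForm]
  | cons i l ih =>
    intro y hl
    have hil : i ∉ l.toFinset := by simpa using (List.nodup_cons.1 hl).1
    set I := (i :: l).toFinset with hI
    have hiI : i ∈ I := by simp [hI]
    have hexp : ∀ x, gridForm lab (i :: l) I x = ∑ a ∈ I,
        (lab i (x + Pi.single a 1) * gridForm lab l (I.erase a) (x + Pi.single a 1)
          - lab i x * gridForm lab l (I.erase a) x) := by
      intro x
      have := gridForm_closed lab l I x
      have h2 : lab i x * ∑ a ∈ I,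
        (gridForm lab l (I.erase a) (x + Pi.single a 1) - gridForm lab l (I.erase a) x) = 0 := by
        rw [this, mul_zero]
      rw [Finset.mul_sum] at h2
      rw [← add_zero (gridForm lab (i :: l) I x), ← h2, gridForm, ← Finset.sum_add_distrib]
      exact Finset.sum_congr rfl fun a _ => by ring
    simp only [hexp]
    rw [Finset.sum_comm, Finset.sum_eq_single_of_mem i hiI]
    · rw [sum_gridBox_diff N I y hiI (fun x => lab i x * gridForm lab l (I.erase i) x)]
      have hIe : I.erase i = l.toFinset := by
        rw [hI, List.toFinset_cons, Finset.erase_insert hil]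
      rw [hIe]
      have hmem : ∀ v, ∀ x ∈ gridBox N l.toFinset (Function.update y i v), x i = v := by
        intro v x hx
        have := mem_gridBox.1 hx i
        simpa [hil] using this
      rw [Finset.sum_congr rfl (g := gridForm lab l l.toFinset)
        (fun x hx => by rw [h1 i x (hmem N x hx), one_mul]),
        ih _ (List.nodup_cons.1 hl).2, Finset.sum_eq_zero, sub_zero]
      intro x hx
      rw [h0 i x (hmem 0 x hx), zero_mul]
    · intro a ha hai
      have hal : a ∈ l := by
        have : a = i ∨ a ∈ l := by simpa [hI] using ha
        exact this.resolve_left hai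
      rw [sum_gridBox_diff N I y ha (fun x => lab i x * gridForm lab l (I.erase a) x)]
      have hz : ∀ v t, (∀ x : ι → ℕ, x a = v → lab a x = t) →
          ∑ x ∈ gridBox N (I.erase a) (Function.update y a v),
            lab i x * gridForm lab l (I.erase a) x = 0 := by
        intro v t hlab
        refine Finset.sum_eq_zero fun x hx => ?_
        have hxa : x a = v := by
          have := mem_gridBox.1 hx a
          simpa using this
        rw [gridForm_eq_zero lab a v t hlab l hal _ x (by simp) hxa, mul_zero]
      rw [hz N 1 (h1 a), hz 0 0 (h0 a), sub_zero]

theorem exists_ne_of_gridForm_ne_zero {ι : Type*} (lab : ι → (ι → ℕ) → ZMod 2) (l : List ι) :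
    ∀ (I : Finset ι) (x : ι → ℕ), gridForm lab l I x ≠ 0 → ∀ i ∈ l,
      ∃ r s : ι → ℕ, (∀ b, x b ≤ r b ∧ r b ≤ x b + if b ∈ I then 1 else 0) ∧
        (∀ b, x b ≤ s b ∧ s b ≤ x b + if b ∈ I then 1 else 0) ∧ lab i r ≠ lab i s := by
  induction l with
  | nil => simp
  | cons j l ih =>
    intro I x hx i hi
    obtain ⟨a, ha, hne⟩ := Finset.exists_ne_zero_of_sum_ne_zero hx
    have hstep : ∀ b, x b ≤ (x + Pi.single a 1 : ι → ℕ) b ∧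
        (x + Pi.single a 1 : ι → ℕ) b ≤ x b + if b ∈ I then 1 else 0 := by
      intro b
      by_cases hb : b = a
      · subst hb; simp [ha]
      · simp [hb]
    rcases List.mem_cons.1 hi with rfl | hi
    · refine ⟨x + Pi.single a 1, x, hstep, fun b => ⟨le_rfl, by simp⟩, ?_⟩
      exact sub_ne_zero.1 (left_ne_zero_of_mul hne)
    · obtain ⟨r, s, hr, hs, hrs⟩ := ih _ _ (right_ne_zero_of_mul hne) i hi
      have : ∀ b, x b ≤ (x + Pi.single a 1 : ι → ℕ) b ∧ (x + Pi.single a 1 : ι → ℕ) b +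
          (if b ∈ I.erase a then 1 else 0) ≤ x b + if b ∈ I then 1 else 0 := by
        intro b
        by_cases hb : b = a
        · subst hb; simp [ha]
        · simp [hb]
      exact ⟨r, s, fun b => ⟨(this b).1.trans (hr b).1, (hr b).2.trans (this b).2⟩,
        fun b => ⟨(this b).1.trans (hs b).1, (hs b).2.trans (this b).2⟩, hrs⟩

/-- Kuhn's cubical Sperner lemma: if the `i`-th label is `0` on the face `x i = 0` and `1` on the
face `x i = N`, then in some unit cell no label is constant. -/
theorem exists_cell_labels_ne {ι : Type*} [Fintype ι] (N : ℕ) (lab : ι → (ι → ℕ) → ZMod 2)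
    (h0 : ∀ i x, x i = 0 → lab i x = 0) (h1 : ∀ i x, x i = N → lab i x = 1) :
    ∃ x : ι → ℕ, (∀ b, x b < N) ∧ ∀ i, ∃ r s : ι → ℕ,
      (∀ b, x b ≤ r b ∧ r b ≤ x b + 1) ∧ (∀ b, x b ≤ s b ∧ s b ≤ x b + 1) ∧
        lab i r ≠ lab i s := by
  have hsum := sum_gridForm N lab h0 h1 (Finset.univ : Finset ι).toList 0 (Finset.nodup_toList _)
  rw [Finset.toList_toFinset] at hsum
  obtain ⟨x, hx, hne⟩ := Finset.exists_ne_zero_of_sum_ne_zero (hsum.trans_ne one_ne_zero)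
  refine ⟨x, fun b => by simpa using mem_gridBox.1 hx b, fun i => ?_⟩
  simpa using exists_ne_of_gridForm_ne_zero lab _ _ x hne i (by simp)

/-- Existence of solutions of mixed complementarity problems (variational inequalities) on a
box. -/
theorem exists_box_complementarity {ι : Type*} [Fintype ι] (a b : ι → ℝ) (hab : a ≤ b)
    (Φ : ι → (ι → ℝ) → ℝ) (hΦ : ∀ i, Continuous (Φ i)) :
    ∃ v ∈ Set.Icc a b, ∀ i, (v i = a i ∨ 0 ≤ Φ i v) ∧ (v i = b i ∨ Φ i v ≤ 0) := by
  let pt : ℕ → (ι → ℕ) → ι → ℝ := fun N x i => a i + (b i - a i) * (x i / (N + 1 : ℕ))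
  have hcell : ∀ N : ℕ, ∃ v ∈ Set.Icc a b, ∀ i, ∃ r s : ι → ℝ,
      (∀ j, |r j - v j| ≤ (b j - a j) * (1 / ((N : ℝ) + 1))) ∧
      (∀ j, |s j - v j| ≤ (b j - a j) * (1 / ((N : ℝ) + 1))) ∧
      (r i = a i ∨ 0 ≤ Φ i r) ∧ (s i = b i ∨ Φ i s ≤ 0) := by
    intro N
    obtain ⟨x, hxN, hx⟩ := exists_cell_labels_ne (N + 1)
      (fun i x => if x i = 0 ∨ (x i ≠ N + 1 ∧ 0 ≤ Φ i (pt N x)) then (0 : ZMod 2) else 1)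
      (fun i x hx => by simp [hx]) (fun i x hx => by simp [hx])
    have hNpos : (0 : ℝ) < (N + 1 : ℕ) := by positivity
    have hdist : ∀ r : ι → ℕ, (∀ j, x j ≤ r j ∧ r j ≤ x j + 1) →
        ∀ j, |pt N r j - pt N x j| ≤ (b j - a j) * (1 / ((N : ℝ) + 1)) := by
      intro r hr j
      have e : pt N r j - pt N x j = (b j - a j) * (((r j : ℝ) - x j) / (N + 1 : ℕ)) := by
        simp only [pt]; ring
      have h1 : (x j : ℝ) ≤ r j := by exact_mod_cast (hr j).1
      have h2 : (r j : ℝ) ≤ x j + 1 := by exact_mod_cast (hr j).2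
      have h3 : 0 ≤ b j - a j := sub_nonneg.2 (hab j)
      rw [e, abs_of_nonneg (mul_nonneg h3 (div_nonneg (by linarith) hNpos.le))]
      push_cast
      gcongr
      linarith
    refine ⟨pt N x, ⟨fun j => ?_, fun j => ?_⟩, fun i => ?_⟩
    · have : 0 ≤ (b j - a j) * ((x j : ℝ) / (N + 1 : ℕ)) :=
        mul_nonneg (sub_nonneg.2 (hab j)) (by positivity)
      simp only [pt]; linarith
    · have : (b j - a j) * ((x j : ℝ) / (N + 1 : ℕ)) ≤ (b j - a j) * 1 := by
        refine mul_le_mul_of_nonneg_left ?_ (sub_nonneg.2 (hab j))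
        rw [div_le_one hNpos]
        exact_mod_cast (hxN j).le
      simp only [pt]; linarith
    · have h0 : ∀ r : ι → ℕ, (r i = 0 ∨ (r i ≠ N + 1 ∧ 0 ≤ Φ i (pt N r))) →
          (pt N r i = a i ∨ 0 ≤ Φ i (pt N r)) := by
        rintro r (h | h)
        · left; simp [pt, h]
        · exact Or.inr h.2
      have h1 : ∀ r : ι → ℕ, ¬ (r i = 0 ∨ (r i ≠ N + 1 ∧ 0 ≤ Φ i (pt N r))) →
          (pt N r i = b i ∨ Φ i (pt N r) ≤ 0) := by
        intro r h
        by_cases hr : r i = N + 1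
        · left
          simp only [pt, hr]
          rw [div_self hNpos.ne']; ring
        · right
          by_contra hc
          exact h (Or.inr ⟨hr, (not_le.1 hc).le⟩)
      obtain ⟨r, s, hr, hs, hrs⟩ := hx i
      by_cases hcr : r i = 0 ∨ (r i ≠ N + 1 ∧ 0 ≤ Φ i (pt N r)) <;>
        by_cases hcs : s i = 0 ∨ (s i ≠ N + 1 ∧ 0 ≤ Φ i (pt N s))
      · simp [hcr, hcs] at hrs
      · exact ⟨_, _, hdist r hr, hdist s hs, h0 r hcr, h1 s hcs⟩
      · exact ⟨_, _, hdist s hs, hdist r hr, h0 s hcs, h1 r hcr⟩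
      · simp [hcr, hcs] at hrs
  choose v hv r s hr hs hrC hsD using hcell
  obtain ⟨v₀, hv₀, φ, hφ, hlim⟩ := isCompact_Icc.tendsto_subseq hv
  refine ⟨v₀, hv₀, fun i => ?_⟩
  have hsq : ∀ t : ℕ → ι → ℝ,
      (∀ N j, |t N j - v N j| ≤ (b j - a j) * (1 / ((N : ℝ) + 1))) →
      Filter.Tendsto (t ∘ φ) Filter.atTop (nhds v₀) := by
    intro t ht
    rw [tendsto_pi_nhds] at hlim ⊢
    intro j
    have hz : Filter.Tendsto (fun N : ℕ => (b j - a j) * (1 / ((N : ℝ) + 1)))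
        Filter.atTop (nhds 0) := by
      simpa using tendsto_one_div_add_atTop_nhds_zero_nat.const_mul (b j - a j)
    have hd : Filter.Tendsto (fun N => t N j - v N j) Filter.atTop (nhds 0) :=
      squeeze_zero_norm (fun N => ht N j) hz
    have := (hd.comp hφ.tendsto_atTop).add (hlim j)
    simpa [Function.comp_def] using this
  constructor
  · have hcl : IsClosed {w : ι → ℝ | w i = a i ∨ 0 ≤ Φ i w} :=
      (isClosed_eq (continuous_apply i) continuous_const).union
        (isClosed_le continuous_const (hΦ i))
    exact hcl.mem_of_tendsto (hsq (fun N => r N i) (fun N => hr N i))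
      (Filter.Eventually.of_forall fun N => hrC (φ N) i)
  · have hcl : IsClosed {w : ι → ℝ | w i = b i ∨ Φ i w ≤ 0} :=
      (isClosed_eq (continuous_apply i) continuous_const).union
        (isClosed_le (hΦ i) continuous_const)
    exact hcl.mem_of_tendsto (hsq (fun N => s N i) (fun N => hs N i))
      (Filter.Eventually.of_forall fun N => hsD (φ N) i)

/-- A limiting form of `exists_box_complementarity`: the lower bounds of the coordinates in `S` are
perturbed to be positive, which keeps one of these coordinates positive in the limit. -/
theorem exists_box_complementarity_pos {ι : Type*} [Fintype ι] (b : ι → ℝ) (hb : 0 ≤ b)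
    (S : Set ι) (hS : S.Nonempty) (hbS : ∀ i ∈ S, 0 < b i) (Φ : ι → (ι → ℝ) → ℝ)
    (hΦ : ∀ i, Continuous (Φ i)) :
    ∃ v ∈ Set.Icc 0 b, (∃ i ∈ S, 0 < v i) ∧
      (∀ i ∉ S, (v i = 0 ∨ 0 ≤ Φ i v) ∧ (v i = b i ∨ Φ i v ≤ 0)) ∧
      ((∀ i ∈ S, Φ i v ≤ 0) ∨
        ∀ i ∈ S, (v i = 0 ∨ 0 ≤ Φ i v) ∧ (v i = b i ∨ Φ i v ≤ 0)) := by
  let a : ℕ → ι → ℝ := fun m i => if i ∈ S then b i / (m + 1) else 0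
  have ha0 : ∀ m, 0 ≤ a m := fun m i => by
    simp only [a, Pi.zero_apply]
    split_ifs
    · exact div_nonneg (hb i) (by positivity)
    · exact le_rfl
  have hab : ∀ m, a m ≤ b := fun m i => by
    simp only [a]
    split_ifs
    · exact div_le_self (hb i) (by linarith [m.cast_nonneg (α := ℝ)])
    · exact hb i
  choose v hv hvΦ using fun m => exists_box_complementarity (a m) b (hab m) Φ hΦ
  have hv0 : ∀ m, v m ∈ Set.Icc 0 b := fun m => ⟨(ha0 m).trans (hv m).1, (hv m).2⟩
  by_cases hcase : ∃ m, ∀ i ∈ S, Φ i (v m) ≤ 0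
  · obtain ⟨m, hm⟩ := hcase
    obtain ⟨i, hi⟩ := hS
    refine ⟨v m, hv0 m, ⟨i, hi, ?_⟩, fun i hi => ?_, Or.inl hm⟩
    · refine lt_of_lt_of_le ?_ ((hv m).1 i)
      simp only [a, hi, if_true]
      exact div_pos (hbS i hi) (by positivity)
    · simpa [a, hi] using hvΦ m i
  · push Not at hcase
    let K : ℕ → Set (ι → ℝ) := fun m => {x | x ∈ Set.Icc 0 b ∧ (∃ i : S, x i = b i) ∧
      ∀ i, (x i ≤ a m i ∨ 0 ≤ Φ i x) ∧ (x i = b i ∨ Φ i x ≤ 0)}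
    have hKclosed : ∀ m, IsClosed (K m) := fun m => by
      simp only [K, Set.ofPred_and, Set.ofPred_exists, Set.ofPred_forall, Set.ofPred_or]
      refine isClosed_Icc.inter (IsClosed.inter (isClosed_iUnion_of_finite fun i =>
        isClosed_eq (continuous_apply _) continuous_const) (isClosed_iInter fun i => ?_))
      exact ((isClosed_le (continuous_apply i) continuous_const).union
        (isClosed_le continuous_const (hΦ i))).inter
        ((isClosed_eq (continuous_apply i) continuous_const).union
          (isClosed_le (hΦ i) continuous_const))
    have hanti : ∀ m i, a (m + 1) i ≤ a m i := fun m i => by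
      simp only [a]
      split_ifs
      · exact div_le_div_of_nonneg_left (hb i) (by positivity) (by push_cast; linarith)
      · exact le_rfl
    obtain ⟨x, hx⟩ := IsCompact.nonempty_iInter_of_sequence_nonempty_isCompact_isClosed K
      (fun m x hx => ⟨hx.1, hx.2.1, fun i =>
        ⟨(hx.2.2 i).1.imp_left fun e => e.trans (hanti m i), (hx.2.2 i).2⟩⟩)
      (fun m => by
        obtain ⟨i, hi, hpos⟩ := hcase m
        exact ⟨v m, hv0 m, ⟨⟨i, hi⟩, (hvΦ m i).2.resolve_right hpos.not_ge⟩, fun i =>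
          ⟨(hvΦ m i).1.imp_left fun e => e.le, (hvΦ m i).2⟩⟩)
      (isCompact_Icc.of_isClosed_subset (hKclosed 0) fun x hx => hx.1) hKclosed
    rw [Set.mem_iInter] at hx
    have hcomp : ∀ i, (x i = 0 ∨ 0 ≤ Φ i x) ∧ (x i = b i ∨ Φ i x ≤ 0) := fun i => by
      refine ⟨or_iff_not_imp_right.2 fun hneg => le_antisymm ?_ ((hx 0).1.1 i),
        ((hx 0).2.2 i).2⟩
      have hle : ∀ m : ℕ, x i ≤ b i * (1 / ((m : ℝ) + 1)) := fun m => by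
        refine (((hx m).2.2 i).1.resolve_right hneg).trans ?_
        simp only [a]
        split_ifs
        · exact (mul_one_div _ _).ge
        · exact mul_nonneg (hb i) (by positivity)
      simpa using ge_of_tendsto' (tendsto_one_div_add_atTop_nhds_zero_nat.const_mul (b i)) hle
    obtain ⟨i, hi⟩ := (hx 0).2.1
    exact ⟨x, (hx 0).1, ⟨i, i.2, hi ▸ hbS i i.2⟩, fun i _ => hcomp i,
      Or.inr fun i _ => hcomp i⟩

namespace SPLCMarket

variable (M : SPLCMarket)

/-! ### Price vectors at which no firm makes a profit -/

theorem finite_slopes : {x | ∃ f j k, k < M.numP f j ∧ M.α f j k = x}.Finite := by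
  have : {x | ∃ f j k, k < M.numP f j ∧ M.α f j k = x} ⊆
      ⋃ f, ⋃ j, (fun k => M.α f j k) '' (Finset.range (M.numP f j) : Set ℕ) := by
    rintro x ⟨f, j, k, hk, rfl⟩
    simp only [Set.mem_iUnion]
    exact ⟨f, j, k, by simpa using hk, rfl⟩
  exact (Set.finite_iUnion fun f => Set.finite_iUnion fun j =>
    (Finset.finite_toSet _).image _).subset this

theorem αmax_nonneg : 0 ≤ M.αmax :=
  le_csSup (M.finite_slopes.insert 0).bddAbove (Set.mem_insert _ _)

theorem α_le_αmax {f : M.F} {j : M.G} {k : ℕ} (hk : k < M.numP f j) : M.α f j k ≤ M.αmax :=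
  le_csSup (M.finite_slopes.insert 0).bddAbove (Set.mem_insert_of_mem _ ⟨f, j, k, hk, rfl⟩)

theorem αminpos_le {f : M.F} {j : M.G} {k : ℕ} (hk : k < M.numP f j) (hpos : 0 < M.α f j k) :
    M.αminpos ≤ M.α f j k :=
  csInf_le ⟨0, fun _ hx => hx.1.le⟩ ⟨hpos, f, j, k, hk, rfl⟩

theorem α_le_first (f : M.F) (j : M.G) (k : ℕ) (hk : k < M.numP f j) :
    M.α f j k ≤ M.α f j 0 := by
  induction k with
  | zero => exact le_rfl
  | succ k ih => exact (M.α_anti f j k hk).le.trans (ih (by omega))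

theorem cycle_prod_le_one (hnp : M.NoProductionOutOfNothing) (fs : ℕ → M.F) (gs : ℕ → M.G)
    (d : ℕ) (hfg : ∀ t < d, M.jf (fs t) = gs (t + 1)) (hcyc : gs d = gs 0) :
    ∏ t ∈ Finset.range d, M.α (fs t) (gs t) 0 ≤ 1 := by
  by_cases hpos : ∀ t < d, 0 < M.α (fs t) (gs t) 0
  · rcases d with _ | m
    · simp
    · have := hnp m (fun t => fs t) (fun t => gs t) (fun t => hpos t t.2) (fun t => by
        rw [hfg t t.2]
        by_cases ht : (t : ℕ) + 1 < m + 1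
        · rw [Fin.val_add_one_of_lt' ht]
        · have hlast : t = Fin.last m := Fin.ext (by have := t.2; simp; omega)
          subst hlast
          simp [hcyc])
      rw [Finset.prod_range]
      exact this.le
  · push Not at hpos
    obtain ⟨t, ht, h0⟩ := hpos
    have : M.α (fs t) (gs t) 0 = 0 := le_antisymm h0 (M.α_nonneg _ _ _ (M.numP_pos _ _))
    rw [Finset.prod_eq_zero (Finset.mem_range.2 ht) this]
    exact zero_le_one

theorem walk_prod_le (hnp : M.NoProductionOutOfNothing) (T : ℕ) :
    ∀ (fs : ℕ → M.F) (gs : ℕ → M.G), (∀ t < T, M.jf (fs t) = gs (t + 1)) →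
      ∏ t ∈ Finset.range T, M.α (fs t) (gs t) 0 ≤ (M.αmax + 1) ^ (Fintype.card M.G - 1) := by
  induction T using Nat.strong_induction_on with
  | _ T ih =>
    intro fs gs hfg
    have hnn : ∀ f j, 0 ≤ M.α f j 0 := fun f j => M.α_nonneg _ _ _ (M.numP_pos _ _)
    have hmax := M.αmax_nonneg
    by_cases hT : T ≤ Fintype.card M.G - 1
    · calc ∏ t ∈ Finset.range T, M.α (fs t) (gs t) 0
          ≤ ∏ t ∈ Finset.range T, (M.αmax + 1) :=
            Finset.prod_le_prod (fun t _ => hnn _ _) fun t _ =>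
              (M.α_le_αmax (M.numP_pos _ _)).trans (by linarith)
        _ = (M.αmax + 1) ^ T := by simp
        _ ≤ _ := pow_le_pow_right₀ (by linarith) hT
    · obtain ⟨s, d, e, hd0, rfl, hss⟩ : ∃ s d e, 0 < d ∧ T = s + d + e ∧ gs s = gs (s + d) := by
        obtain ⟨s, s', hne, hss⟩ := Fintype.exists_ne_map_eq_of_card_lt
          (fun t : Fin (T + 1) => gs t) (by simp; omega)
        wlog hlt : s < s' generalizing s s'
        · exact this s' s hne.symm hss.symm (lt_of_le_of_ne (not_lt.1 hlt) hne.symm)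
        refine ⟨s, s' - s, T - s', by omega, by omega, ?_⟩
        rw [Nat.add_sub_cancel' (by omega)]
        exact hss
      rw [Finset.prod_range_add, Finset.prod_range_add]
      have hmid := M.cycle_prod_le_one hnp (fun t => fs (s + t)) (fun t => gs (s + t)) d
        (fun t ht => hfg _ (by omega)) hss.symm
      have hcut := ih (s + e) (by omega) (fun t => if t < s then fs t else fs (t + d))
        (fun t => if t < s then gs t else gs (t + d)) (fun t ht => by
          by_cases h1 : t < s
          · by_cases h2 : t + 1 < s
            · simp only [h1, h2, if_true]; exact hfg _ (by omega)
            · have h3 : t + 1 = s := by omega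
              simp only [h1, h3, lt_irrefl, if_true, if_false]
              rw [hfg _ (by omega), h3, hss]
          · have h2 : ¬ t + 1 < s := by omega
            simp only [h1, h2, if_false]
            rw [hfg _ (by omega)]
            congr 1; omega)
      rw [Finset.prod_range_add] at hcut
      refine le_trans ?_ hcut
      have e1 : ∏ t ∈ Finset.range s, M.α (if t < s then fs t else fs (t + d))
          (if t < s then gs t else gs (t + d)) 0 = ∏ t ∈ Finset.range s, M.α (fs t) (gs t) 0 :=
        Finset.prod_congr rfl fun t ht => by simp [Finset.mem_range.1 ht]
      have e2 : ∏ t ∈ Finset.range e, M.α (if s + t < s then fs (s + t) else fs (s + t + d))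
          (if s + t < s then gs (s + t) else gs (s + t + d)) 0 =
          ∏ t ∈ Finset.range e, M.α (fs (s + d + t)) (gs (s + d + t)) 0 :=
        Finset.prod_congr rfl fun t _ => by simp [add_right_comm s t d]
      rw [e1, e2]
      refine mul_le_mul_of_nonneg_right ?_ (Finset.prod_nonneg fun _ _ => hnn _ _)
      exact mul_le_of_le_one_right (Finset.prod_nonneg fun _ _ => hnn _ _) hmid

/-- Under no production out of nothing there are prices, not too far apart, at which no
production segment is profitable. -/
theorem exists_unprofitable_prices (hnp : M.NoProductionOutOfNothing) :
    ∃ c : M.G → ℝ, (∀ j, 1 ≤ c j) ∧ (∀ j, c j ≤ (M.αmax + 1) ^ (Fintype.card M.G - 1)) ∧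
      ∀ f j k, k < M.numP f j → M.α f j k * c (M.jf f) ≤ c j := by
  let S : M.G → Set ℝ := fun j => {x | ∃ (T : ℕ) (fs : ℕ → M.F) (gs : ℕ → M.G),
    gs 0 = j ∧ (∀ t < T, M.jf (fs t) = gs (t + 1)) ∧
      x = ∏ t ∈ Finset.range T, M.α (fs t) (gs t) 0}
  have hmax := M.αmax_nonneg
  have hub : ∀ j, ∀ x ∈ insert 1 (S j), x ≤ (M.αmax + 1) ^ (Fintype.card M.G - 1) := by
    rintro j x (rfl | ⟨T, fs, gs, -, hfg, rfl⟩)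
    · exact one_le_pow₀ (by linarith)
    · exact M.walk_prod_le hnp T fs gs hfg
  have hbdd : ∀ j, BddAbove (insert 1 (S j)) := fun j => ⟨_, hub j⟩
  refine ⟨fun j => sSup (insert 1 (S j)), fun j => le_csSup (hbdd j) (Set.mem_insert _ _),
    fun j => csSup_le ⟨1, Set.mem_insert _ _⟩ (hub j), fun f j k hk => ?_⟩
  have hext : ∀ x ∈ insert 1 (S (M.jf f)), M.α f j 0 * x ≤ sSup (insert 1 (S j)) := by
    rintro x (rfl | ⟨T, fs, gs, hg, hfg, rfl⟩)
    · refine le_csSup (hbdd j) (Set.mem_insert_of_mem _ ⟨1, fun _ => f,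
        fun t => if t = 0 then j else M.jf f, by simp, fun t _ => by simp, by simp⟩)
    · refine le_csSup (hbdd j) (Set.mem_insert_of_mem _ ⟨T + 1, fun t => Nat.casesOn t f fs,
        fun t => Nat.casesOn t j gs, rfl, fun t ht => ?_, ?_⟩)
      · rcases t with _ | t
        · exact hg.symm
        · exact hfg t (by omega)
      · rw [Finset.prod_range_succ', mul_comm]
        rfl
  have h1 : 0 ≤ sSup (insert 1 (S (M.jf f))) :=
    zero_le_one.trans (le_csSup (hbdd _) (Set.mem_insert _ _))
  refine (mul_le_mul_of_nonneg_right (M.α_le_first f j k hk) h1).trans ?_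
  rcases (M.α_nonneg f j 0 (M.numP_pos f j)).eq_or_lt with h0 | h0
  · rw [← h0, zero_mul]
    exact zero_le_one.trans (le_csSup (hbdd _) (Set.mem_insert _ _))
  · rw [mul_comm, ← le_div_iff₀ h0]
    refine csSup_le ⟨1, Set.mem_insert _ _⟩ fun x hx => ?_
    rw [le_div_iff₀ h0, mul_comm]
    exact hext x hx

end SPLCMarket

namespace SPLCMarket

variable (M : SPLCMarket)

/-! ### Complementarity systems for the market -/

/-- The unspent part of the budget of agent `i`. -/
def unspent (p : M.G → ℝ) (xF : M.F → M.G → ℕ → ℝ) (xA : M.A → M.G → ℕ → ℝ) (i : M.A) : ℝ :=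
  M.budget i p (fun f => M.planProfit f p (xF f)) -
    M.bundleCost p (fun j => ∑ k ∈ Finset.range (M.numU i j), xA i j k)

/-- The excess demand for good `j`. -/
def excess (xF : M.F → M.G → ℕ → ℝ) (xA : M.A → M.G → ℕ → ℝ) (j : M.G) : ℝ :=
  (∑ i, ∑ k ∈ Finset.range (M.numU i j), xA i j k)
    + (∑ f, ∑ k ∈ Finset.range (M.numP f j), xF f j k)
    - (1 + ∑ f, if M.jf f = j then M.planOutput f (xF f) else 0)

/-- The plans of the firms, the bundles of the agents and the marginal values `lam` of money
(bounded by `Λ`) are complementary at prices `p`. -/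
structure IsComplementary (Λ : ℝ) (p : M.G → ℝ) (xF : M.F → M.G → ℕ → ℝ)
    (xA : M.A → M.G → ℕ → ℝ) (lam : M.A → ℝ) : Prop where
  p_nonneg : ∀ j, 0 ≤ p j
  plan : ∀ f, M.IsPlan f (xF f)
  plan_lo : ∀ f j k, k < M.numP f j →
    xF f j k = 0 ∨ 0 ≤ M.α f j k * p (M.jf f) - p j
  plan_hi : ∀ f j k, k < M.numP f j →
    xF f j k = M.o f j k ∨ M.α f j k * p (M.jf f) - p j ≤ 0
  alloc : ∀ i, M.IsSegAlloc (M.numU i) (M.l i) (xA i)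
  alloc_lo : ∀ i j k, k < M.numU i j → xA i j k = 0 ∨ 0 ≤ M.u i j k * lam i - p j
  alloc_hi : ∀ i j k, k < M.numU i j → xA i j k = M.l i j k ∨ M.u i j k * lam i - p j ≤ 0
  lam_nonneg : ∀ i, 0 ≤ lam i
  lam_le : ∀ i, lam i ≤ Λ
  lam_lo : ∀ i, lam i = 0 ∨ 0 ≤ M.unspent p xF xA i
  lam_hi : ∀ i, lam i = Λ ∨ M.unspent p xF xA i ≤ 0

theorem sum_segAmt_eq {len : ℕ → ℝ} {t : ℝ} (ht : 0 ≤ t) (n : ℕ) (hlen : ∀ k < n, 0 ≤ len k) :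
    ∑ k ∈ Finset.range n, segAmt len k t = min t (∑ k ∈ Finset.range n, len k) := by
  induction n with
  | zero => simp [ht]
  | succ n ih =>
    rw [Finset.sum_range_succ, ih fun k hk => hlen k (by omega), segAmt, Finset.sum_range_succ]
    have := hlen n (by omega)
    generalize ∑ k ∈ Finset.range n, len k = S
    rcases le_total t S with h | h
    · rw [min_eq_left h, min_eq_left (by linarith : t ≤ S + len n),
        min_eq_right (by linarith : t - S ≤ len n), max_eq_left (by linarith), add_zero]
    · rw [min_eq_right h]
      rcases le_total (len n) (t - S) with h' | h'
      · rw [min_eq_left h', max_eq_right this, min_eq_right (by linarith)]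
      · rw [min_eq_right h', max_eq_right (by linarith), min_eq_left (by linarith)]
        ring

theorem segAmt_nonneg (len : ℕ → ℝ) (k : ℕ) (t : ℝ) : 0 ≤ segAmt len k t := le_max_left _ _

theorem segAmt_le {len : ℕ → ℝ} {k : ℕ} (hk : 0 ≤ len k) (t : ℝ) : segAmt len k t ≤ len k :=
  max_le hk (min_le_left _ _)

theorem planProfit_eq (f : M.F) (p : M.G → ℝ) (x : M.G → ℕ → ℝ) :
    M.planProfit f p x = p (M.jf f) * M.planOutput f x -
      ∑ j, p j * ∑ k ∈ Finset.range (M.numP f j), x j k := by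
  simp only [planProfit, planOutput, Finset.mul_sum, ← Finset.sum_sub_distrib]
  refine Finset.sum_congr rfl fun j _ => Finset.sum_congr rfl fun k _ => ?_
  ring

/-- The budgets of the agents exhaust endowments and profits. -/
theorem sum_budget (p : M.G → ℝ) (E : M.F → ℝ) : ∑ i, M.budget i p E = ∑ j, p j + ∑ f, E f := by
  simp only [budget, Finset.sum_add_distrib]
  rw [Finset.sum_comm, Finset.sum_comm (f := fun i f => M.θ i f * E f)]
  simp only [← Finset.sum_mul, M.w_sum, M.θ_sum, one_mul]

/-- Walras's law. -/
theorem walras (p : M.G → ℝ) (xF : M.F → M.G → ℕ → ℝ) (xA : M.A → M.G → ℕ → ℝ) :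
    ∑ j, p j * M.excess xF xA j = - ∑ i, M.unspent p xF xA i := by
  have h1 : ∑ j, p j * ∑ f, (if M.jf f = j then M.planOutput f (xF f) else 0) =
      ∑ f, p (M.jf f) * M.planOutput f (xF f) := by
    simp only [Finset.mul_sum]
    rw [Finset.sum_comm]
    exact Finset.sum_congr rfl fun f _ => by simp
  have h2 : ∑ j, p j * ∑ f, ∑ k ∈ Finset.range (M.numP f j), xF f j k =
      ∑ f, ∑ j, p j * ∑ k ∈ Finset.range (M.numP f j), xF f j k := by
    rw [Finset.sum_comm]
    exact Finset.sum_congr rfl fun j _ => Finset.mul_sum _ _ _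
  have h3 : ∑ j, p j * ∑ i, ∑ k ∈ Finset.range (M.numU i j), xA i j k =
      ∑ i, M.bundleCost p (fun j => ∑ k ∈ Finset.range (M.numU i j), xA i j k) := by
    simp only [bundleCost]
    rw [Finset.sum_comm]
    exact Finset.sum_congr rfl fun j _ => Finset.mul_sum _ _ _
  simp only [unspent, excess, mul_sub, mul_add, mul_one, Finset.sum_sub_distrib,
    Finset.sum_add_distrib, h1, h2, h3, M.sum_budget, M.planProfit_eq]
  ring

/-- If no firm producing a good of `Z` uses goods outside `Z`, then the value, at unprofitable
prices `c`, of the goods of `Z` taken out of the production within `Z` is at most the value of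
the endowments of goods of `Z`. -/
theorem value_le {c : M.G → ℝ} (hc0 : ∀ j, 0 ≤ c j)
    (hc : ∀ f j k, k < M.numP f j → M.α f j k * c (M.jf f) ≤ c j)
    {xF : M.F → M.G → ℕ → ℝ} {xA : M.A → M.G → ℕ → ℝ} (hplan : ∀ f, M.IsPlan f (xF f))
    (hz : ∀ j, M.excess xF xA j ≤ 0) (Z : Finset M.G)
    (hZ : ∀ f j k, M.jf f ∈ Z → j ∉ Z → k < M.numP f j → xF f j k = 0) :
    ∑ j ∈ Z, c j * (∑ i, ∑ k ∈ Finset.range (M.numU i j), xA i j k) +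
      ∑ f, (if M.jf f ∈ Z then 0 else
        ∑ j ∈ Z, c j * ∑ k ∈ Finset.range (M.numP f j), xF f j k) ≤ ∑ j ∈ Z, c j := by
  have h1 : ∑ j ∈ Z, c j * M.excess xF xA j ≤ 0 :=
    Finset.sum_nonpos fun j _ => mul_nonpos_of_nonneg_of_nonpos (hc0 j) (hz j)
  have h2 : ∑ j ∈ Z, c j * ∑ f, (if M.jf f = j then M.planOutput f (xF f) else 0) =
      ∑ f, if M.jf f ∈ Z then c (M.jf f) * M.planOutput f (xF f) else 0 := by
    simp only [Finset.mul_sum]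
    rw [Finset.sum_comm]
    exact Finset.sum_congr rfl fun f _ => by simp
  have h3 : ∑ j ∈ Z, c j * ∑ f, ∑ k ∈ Finset.range (M.numP f j), xF f j k =
      ∑ f, ∑ j ∈ Z, c j * ∑ k ∈ Finset.range (M.numP f j), xF f j k := by
    rw [Finset.sum_comm]
    exact Finset.sum_congr rfl fun j _ => Finset.mul_sum _ _ _
  have h4 : ∀ f, (if M.jf f ∈ Z then c (M.jf f) * M.planOutput f (xF f) else 0) +
      (if M.jf f ∈ Z then 0 else ∑ j ∈ Z, c j * ∑ k ∈ Finset.range (M.numP f j), xF f j k) ≤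
      ∑ j ∈ Z, c j * ∑ k ∈ Finset.range (M.numP f j), xF f j k := by
    intro f
    split_ifs with hf
    · rw [add_zero, planOutput, ← Finset.sum_subset (Finset.subset_univ Z), Finset.mul_sum]
      · refine Finset.sum_le_sum fun j _ => ?_
        rw [Finset.mul_sum, Finset.mul_sum]
        refine Finset.sum_le_sum fun k hk => ?_
        have := mul_le_mul_of_nonneg_right (hc f j k (Finset.mem_range.1 hk)) (hplan f j k).1
        linarith
      · intro j _ hj
        refine Finset.sum_eq_zero fun k hk => ?_
        rw [hZ f j k hf hj (Finset.mem_range.1 hk), mul_zero]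
    · rw [zero_add]
  have h5 := Finset.sum_le_sum fun f (_ : f ∈ Finset.univ) => h4 f
  rw [Finset.sum_add_distrib] at h5
  simp only [excess, mul_sub, mul_add, mul_one, Finset.sum_sub_distrib,
    Finset.sum_add_distrib, h2, h3] at h1
  linarith

namespace IsComplementary

variable {M} {Λ : ℝ} {p : M.G → ℝ} {xF : M.F → M.G → ℕ → ℝ} {xA : M.A → M.G → ℕ → ℝ}
  {lam : M.A → ℝ}

theorem optimalPlan (h : M.IsComplementary Λ p xF xA lam) (f : M.F) :
    M.OptimalPlan f p (xF f) := by
  refine ⟨h.plan f, fun x' hx' => Finset.sum_le_sum fun j _ => Finset.sum_le_sum fun k hk => ?_⟩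
  have hk := Finset.mem_range.1 hk
  have h0 := (hx' j k).1
  have h1 := (hx' j k).2.1 hk
  have h2 := (h.plan f j k).1
  have h3 := (h.plan f j k).2.1 hk
  rcases h.plan_lo f j k hk with e | e <;> rcases h.plan_hi f j k hk with e' | e'
  · have : M.o f j k = 0 := e'.symm.trans e
    rw [show x' j k = xF f j k by linarith]
  · rw [e, zero_mul]
    exact mul_nonpos_of_nonneg_of_nonpos h0 e'
  · rw [e']
    exact mul_le_mul_of_nonneg_right h1 e
  · rw [le_antisymm e' e, mul_zero, mul_zero]

theorem planProfit_nonneg (h : M.IsComplementary Λ p xF xA lam) (f : M.F) :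
    0 ≤ M.planProfit f p (xF f) := by
  refine Finset.sum_nonneg fun j _ => Finset.sum_nonneg fun k hk => ?_
  rcases h.plan_lo f j k (Finset.mem_range.1 hk) with e | e
  · rw [e, zero_mul]
  · exact mul_nonneg (h.plan f j k).1 e

theorem budget_nonneg (h : M.IsComplementary Λ p xF xA lam) (i : M.A) :
    0 ≤ M.budget i p (fun f => M.planProfit f p (xF f)) :=
  add_nonneg (Finset.sum_nonneg fun j _ => mul_nonneg (M.w_nonneg i j) (h.p_nonneg j))
    (Finset.sum_nonneg fun f _ => mul_nonneg (M.θ_nonneg i f) (h.planProfit_nonneg f))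

theorem bundleCost_eq_zero (h : M.IsComplementary Λ p xF xA lam) {i : M.A} (hi : lam i = 0) :
    M.bundleCost p (fun j => ∑ k ∈ Finset.range (M.numU i j), xA i j k) = 0 := by
  refine Finset.sum_eq_zero fun j _ => ?_
  rw [Finset.mul_sum]
  refine Finset.sum_eq_zero fun k hk => ?_
  rcases h.alloc_lo i j k (Finset.mem_range.1 hk) with e | e
  · rw [e, mul_zero]
  · rw [hi, mul_zero, zero_sub] at e
    rw [le_antisymm (by linarith) (h.p_nonneg j), zero_mul]

theorem unspent_nonneg (h : M.IsComplementary Λ p xF xA lam) (i : M.A) :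
    0 ≤ M.unspent p xF xA i := by
  rcases h.lam_lo i with e | e
  · rw [unspent, h.bundleCost_eq_zero e, sub_zero]
    exact h.budget_nonneg i
  · exact e

/-- A marginal value of money that is positive makes the bundle of the agent optimal. -/
theorem optimalBundle (h : M.IsComplementary Λ p xF xA lam) {i : M.A} (hi : 0 < lam i)
    (hun : M.unspent p xF xA i = 0) :
    M.OptimalBundle i p (M.budget i p (fun f => M.planProfit f p (xF f))) (xA i) := by
  refine ⟨h.alloc i, (sub_eq_zero.1 hun).ge, fun y hy hcost => ?_⟩
  refine le_of_mul_le_mul_left ?_ hi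
  have h1 : ∀ j, ∑ k ∈ Finset.range (M.numU i j), segAmt (M.l i j) k (y j) ≤ y j := fun j => by
    rw [sum_segAmt_eq (hy j) _ fun k hk => (M.l_pos i j k hk).le]
    exact min_le_left _ _
  have h2 : ∑ j, p j * ∑ k ∈ Finset.range (M.numU i j), segAmt (M.l i j) k (y j) ≤
      M.bundleCost p (fun j => ∑ k ∈ Finset.range (M.numU i j), xA i j k) :=
    (Finset.sum_le_sum fun j _ => mul_le_mul_of_nonneg_left (h1 j) (h.p_nonneg j)).trans
      (hcost.trans (sub_eq_zero.1 hun).le)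
  have h3 : ∑ j, ∑ k ∈ Finset.range (M.numU i j),
      (M.u i j k * lam i - p j) * segAmt (M.l i j) k (y j) ≤
      ∑ j, ∑ k ∈ Finset.range (M.numU i j), (M.u i j k * lam i - p j) * xA i j k := by
    refine Finset.sum_le_sum fun j _ => Finset.sum_le_sum fun k hk => ?_
    have hk := Finset.mem_range.1 hk
    have hl := (M.l_pos i j k hk).le
    rcases h.alloc_lo i j k hk with e | e <;> rcases h.alloc_hi i j k hk with e' | e'
    · exact absurd (e.symm.trans e') (M.l_pos i j k hk).ne
    · rw [e, mul_zero]
      exact mul_nonpos_of_nonpos_of_nonneg e' (segAmt_nonneg _ _ _)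
    · rw [e']
      exact mul_le_mul_of_nonneg_left (segAmt_le hl _) e
    · rw [le_antisymm e' e, zero_mul, zero_mul]
  simp only [bundleCost, utilFn, segUtility, Finset.mul_sum, sub_mul,
    Finset.sum_sub_distrib] at h2 h3 ⊢
  have e : ∀ s : M.G → ℕ → ℝ, ∑ j, ∑ k ∈ Finset.range (M.numU i j), lam i * (M.u i j k * s j k) =
      ∑ j, ∑ k ∈ Finset.range (M.numU i j), M.u i j k * lam i * s j k := fun s =>
    Finset.sum_congr rfl fun j _ => Finset.sum_congr rfl fun k _ => by ring
  rw [e (xA i), e fun j k => segAmt (M.l i j) k (y j)]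
  linarith

end IsComplementary

end SPLCMarket

namespace SPLCMarket

namespace IsComplementary

variable {M : SPLCMarket} {Λ : ℝ} {p : M.G → ℝ} {xF : M.F → M.G → ℕ → ℝ}
  {xA : M.A → M.G → ℕ → ℝ} {lam : M.A → ℝ} {c : M.G → ℝ}

theorem alloc_le (h : M.IsComplementary Λ p xF xA lam) (hc1 : ∀ j, 1 ≤ c j)
    (hc : ∀ f j k, k < M.numP f j → M.α f j k * c (M.jf f) ≤ c j)
    (hz : ∀ j, M.excess xF xA j ≤ 0) {Z : Finset M.G}
    (hZ : ∀ f j k, M.jf f ∈ Z → j ∉ Z → k < M.numP f j → xF f j k = 0)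
    {i : M.A} {j : M.G} {k : ℕ} (hj : j ∈ Z) (hk : k < M.numU i j) : xA i j k ≤ ∑ j, c j := by
  have hc0 : ∀ j, 0 ≤ c j := fun j => zero_le_one.trans (hc1 j)
  have hv := M.value_le hc0 hc h.plan hz Z hZ
  have hA : ∀ i j, 0 ≤ ∑ k ∈ Finset.range (M.numU i j), xA i j k := fun i j =>
    Finset.sum_nonneg fun k _ => (h.alloc i j k).1
  have h1 : xA i j k ≤ ∑ i, ∑ k ∈ Finset.range (M.numU i j), xA i j k :=
    (Finset.single_le_sum (f := fun k => xA i j k) (fun k _ => (h.alloc i j k).1)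
      (Finset.mem_range.2 hk)).trans
    (Finset.single_le_sum (f := fun i => ∑ k ∈ Finset.range (M.numU i j), xA i j k)
      (fun i _ => hA i j) (Finset.mem_univ i))
  have h2 := Finset.single_le_sum
    (f := fun j => c j * ∑ i, ∑ k ∈ Finset.range (M.numU i j), xA i j k)
    (fun j _ => mul_nonneg (hc0 j) (Finset.sum_nonneg fun i _ => hA i j)) hj
  have h3 : 0 ≤ ∑ f, (if M.jf f ∈ Z then 0 else
      ∑ j ∈ Z, c j * ∑ k ∈ Finset.range (M.numP f j), xF f j k) := by
    refine Finset.sum_nonneg fun f _ => ?_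
    split_ifs
    · exact le_rfl
    · exact Finset.sum_nonneg fun j _ => mul_nonneg (hc0 j)
        (Finset.sum_nonneg fun k _ => (h.plan f j k).1)
  have h4 : ∑ j ∈ Z, c j ≤ ∑ j, c j :=
    Finset.sum_le_sum_of_subset_of_nonneg (Finset.subset_univ _) fun j _ _ => hc0 j
  have h5 := le_mul_of_one_le_left (Finset.sum_nonneg fun i (_ : i ∈ Finset.univ) => hA i j)
    (hc1 j)
  linarith

theorem plan_le (h : M.IsComplementary Λ p xF xA lam) (hc1 : ∀ j, 1 ≤ c j)
    (hc : ∀ f j k, k < M.numP f j → M.α f j k * c (M.jf f) ≤ c j)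
    (hz : ∀ j, M.excess xF xA j ≤ 0) {Z : Finset M.G}
    (hZ : ∀ f j k, M.jf f ∈ Z → j ∉ Z → k < M.numP f j → xF f j k = 0)
    {f : M.F} {j : M.G} {k : ℕ} (hj : j ∈ Z) (hf : M.jf f ∉ Z) (hk : k < M.numP f j) :
    xF f j k ≤ ∑ j, c j := by
  have hc0 : ∀ j, 0 ≤ c j := fun j => zero_le_one.trans (hc1 j)
  have hv := M.value_le hc0 hc h.plan hz Z hZ
  have hF : ∀ f j, 0 ≤ ∑ k ∈ Finset.range (M.numP f j), xF f j k := fun f j =>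
    Finset.sum_nonneg fun k _ => (h.plan f j k).1
  have h1 : xF f j k ≤ ∑ k ∈ Finset.range (M.numP f j), xF f j k :=
    Finset.single_le_sum (f := fun k => xF f j k) (fun k _ => (h.plan f j k).1)
      (Finset.mem_range.2 hk)
  have h2 := Finset.single_le_sum
    (f := fun j => c j * ∑ k ∈ Finset.range (M.numP f j), xF f j k)
    (fun j _ => mul_nonneg (hc0 j) (hF f j)) hj
  have h3 := Finset.single_le_sum (f := fun f => if M.jf f ∈ Z then 0 else
      ∑ j ∈ Z, c j * ∑ k ∈ Finset.range (M.numP f j), xF f j k) (fun f _ => by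
        split_ifs
        · exact le_rfl
        · exact Finset.sum_nonneg fun j _ => mul_nonneg (hc0 j) (hF f j)) (Finset.mem_univ f)
  simp only [hf, if_false] at h3
  have h4 : ∑ j ∈ Z, c j ≤ ∑ j, c j :=
    Finset.sum_le_sum_of_subset_of_nonneg (Finset.subset_univ _) fun j _ _ => hc0 j
  have h5 : 0 ≤ ∑ j ∈ Z, c j * (∑ i, ∑ k ∈ Finset.range (M.numU i j), xA i j k) :=
    Finset.sum_nonneg fun j _ => mul_nonneg (hc0 j) (Finset.sum_nonneg fun i _ =>
      Finset.sum_nonneg fun k _ => (h.alloc i j k).1)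
  have h6 := le_mul_of_one_le_left (hF f j) (hc1 j)
  linarith

/-- With enough demand, the desires for the goods of `Z` cannot all be satisfied by production
within `Z`. -/
theorem not_satiated (h : M.IsComplementary Λ p xF xA lam) (hdem : M.EnoughDemand)
    (hc1 : ∀ j, 1 ≤ c j) (hc : ∀ f j k, k < M.numP f j → M.α f j k * c (M.jf f) ≤ c j)
    (hz : ∀ j, M.excess xF xA j ≤ 0) {Z : Finset M.G}
    (hZ : ∀ f j k, M.jf f ∈ Z → j ∉ Z → k < M.numP f j → xF f j k = 0)
    (hfull : ∀ i, ∀ j ∈ Z, ∀ k < M.numU i j, 0 < M.u i j k → xA i j k = M.l i j k) :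
    Z = ∅ := by
  by_contra hne
  have hc0 : ∀ j, 0 ≤ c j := fun j => zero_le_one.trans (hc1 j)
  have hv := M.value_le hc0 hc h.plan hz Z hZ
  have h1 : ∀ j ∈ Z, 1 < ∑ i, ∑ k ∈ Finset.range (M.numU i j), xA i j k := by
    intro j hj
    refine (hdem j).trans_le (Finset.sum_le_sum fun i _ => ?_)
    rw [Finset.sum_congr rfl (g := fun k => xA i j k) fun k hk => ?_]
    · exact Finset.sum_le_sum_of_subset_of_nonneg (Finset.filter_subset _ _)
        fun k _ _ => (h.alloc i j k).1
    · rw [Finset.mem_filter, Finset.mem_range] at hk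
      exact (hfull i j hj k hk.1 hk.2).symm
  have h2 : ∑ j ∈ Z, c j < ∑ j ∈ Z, c j * ∑ i, ∑ k ∈ Finset.range (M.numU i j), xA i j k :=
    Finset.sum_lt_sum_of_nonempty (Finset.nonempty_iff_ne_empty.2 hne) fun j hj =>
      lt_mul_of_one_lt_right (zero_lt_one.trans_le (hc1 j)) (h1 j hj)
  have h3 : 0 ≤ ∑ f, (if M.jf f ∈ Z then 0 else
      ∑ j ∈ Z, c j * ∑ k ∈ Finset.range (M.numP f j), xF f j k) := by
    refine Finset.sum_nonneg fun f _ => ?_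
    split_ifs
    · exact le_rfl
    · exact Finset.sum_nonneg fun j _ => mul_nonneg (hc0 j)
        (Finset.sum_nonneg fun k _ => (h.plan f j k).1)
  linarith

theorem lam_pos_of_budget_pos (h : M.IsComplementary Λ p xF xA lam) {i : M.A}
    (hun : M.unspent p xF xA i = 0)
    (hb : 0 < M.budget i p (fun f => M.planProfit f p (xF f))) : 0 < lam i := by
  refine (h.lam_nonneg i).lt_of_ne' fun h0 => hb.ne' ?_
  rw [unspent, h.bundleCost_eq_zero h0, sub_zero] at hun
  exact hun

/-- A complementary state without excess demand at nonzero prices is a market equilibrium. -/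
theorem isEquilibrium (h : M.IsComplementary Λ p xF xA lam) (hsafe : M.SafeLengths)
    (hsc : M.StrongConnectivity) (hdem : M.EnoughDemand)
    (hc1 : ∀ j, 1 ≤ c j) (hc : ∀ f j k, k < M.numP f j → M.α f j k * c (M.jf f) ≤ c j)
    (hcL : ∑ j, c j ≤ M.Lbig)
    (hcF : ∀ f j, 0 < M.α f j (M.numP f j - 1) → ∑ j, c j < M.Lbig / max 1 M.αminpos)
    (hΛ : ∀ i j k, k < M.numU i j → 0 < M.u i j k → p j < M.u i j k * Λ)
    (hz : ∀ j, M.excess xF xA j ≤ 0) (hp : ∃ j, 0 < p j) :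
    M.IsEquilibrium p xF xA (fun f => M.planProfit f p (xF f)) := by
  obtain ⟨j₀, hj₀⟩ := hp
  have hlastU : ∀ i j, M.numU i j - 1 < M.numU i j := fun i j =>
    Nat.sub_lt (M.numU_pos i j) one_pos
  have hlastP : ∀ f j, M.numP f j - 1 < M.numP f j := fun f j =>
    Nat.sub_lt (M.numP_pos f j) one_pos
  have hlam : ∀ i, lam i ≠ Λ := by
    intro i hi
    have hfull : ∀ j, ∀ k < M.numU i j, 0 < M.u i j k → xA i j k = M.l i j k := by
      intro j k hk hu
      refine (h.alloc_hi i j k hk).resolve_right ?_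
      rw [hi, not_le, sub_pos]
      exact hΛ i j k hk hu
    by_cases hi' : ∃ i', i' ≠ i
    · obtain ⟨i', hne⟩ := hi'
      rcases Relation.ReflTransGen.cases_tail (hsc i' i) with e | ⟨b, -, j, -, hj⟩
      · exact hne (Sum.inl_injective e).symm
      · have := h.alloc_le hc1 hc hz (Z := Finset.univ) (by simp) (Finset.mem_univ j)
          (hlastU i j)
        rw [hfull j _ (hlastU i j) hj, hsafe.2] at this
        linarith
    · push Not at hi'
      have := h.not_satiated hdem hc1 hc hz (Z := Finset.univ) (by simp)
        (fun i' j _ k => by rw [hi' i']; exact hfull j k)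
      exact absurd (Finset.mem_univ j₀) (by simp [this])
  have hun : ∀ i, M.unspent p xF xA i = 0 := fun i =>
    le_antisymm ((h.lam_hi i).resolve_left (hlam i)) (h.unspent_nonneg i)
  let Z : Finset M.G := Finset.univ.filter fun j => p j = 0
  have hmemZ : ∀ j, j ∈ Z ↔ p j = 0 := fun j => by simp [Z]
  have hZ : ∀ f j k, M.jf f ∈ Z → j ∉ Z → k < M.numP f j → xF f j k = 0 := by
    intro f j k hf hj hk
    rw [hmemZ] at hf hj
    refine (h.plan_lo f j k hk).resolve_right fun e => hj ?_
    rw [hf, mul_zero, zero_sub] at e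
    exact le_antisymm (by linarith) (h.p_nonneg j)
  let active : M.A ⊕ M.F → Prop := Sum.elim (fun i => 0 < lam i) (fun f => 0 < p (M.jf f))
  have hedge : ∀ a b, M.edge a b → active b → active a := by
    rintro a b ⟨j, ha, hb⟩ hact
    have hpj : 0 < p j := by
      refine (h.p_nonneg j).lt_of_ne' fun hj0 => ?_
      rcases b with i | f
      · have h1 : 0 < M.u i j (M.numU i j - 1) * lam i := mul_pos hb hact
        have h2 := (h.alloc_hi i j _ (hlastU i j)).resolve_right (by rw [hj0]; linarith)
        have h3 := h.alloc_le hc1 hc hz hZ ((hmemZ j).2 hj0) (hlastU i j)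
        rw [h2, hsafe.2] at h3
        linarith
      · have h1 : 0 < M.α f j (M.numP f j - 1) * p (M.jf f) := mul_pos hb hact
        have h2 := (h.plan_hi f j _ (hlastP f j)).resolve_right (by rw [hj0]; linarith)
        have h3 := h.plan_le hc1 hc hz hZ ((hmemZ j).2 hj0)
          (fun e => (ne_of_gt hact) ((hmemZ _).1 e)) (hlastP f j)
        rw [h2, hsafe.1] at h3
        exact (hcF f j hb).not_ge h3
    rcases a with i | f
    · refine h.lam_pos_of_budget_pos (hun i) (add_pos_of_pos_of_nonneg ?_ ?_)
      · exact Finset.sum_pos' (fun j _ => mul_nonneg (M.w_nonneg i j) (h.p_nonneg j))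
          ⟨j, Finset.mem_univ j, mul_pos ha hpj⟩
      · exact Finset.sum_nonneg fun f _ => mul_nonneg (M.θ_nonneg i f) (h.planProfit_nonneg f)
    · have : M.jf f = j := ha
      simpa [active, this] using hpj
  have hsome : ∃ i, 0 < lam i := by
    have hsum : 0 < ∑ i, M.budget i p (fun f => M.planProfit f p (xF f)) := by
      rw [M.sum_budget]
      exact add_pos_of_pos_of_nonneg
        (Finset.sum_pos' (fun j _ => h.p_nonneg j) ⟨j₀, Finset.mem_univ _, hj₀⟩)
        (Finset.sum_nonneg fun f _ => h.planProfit_nonneg f)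
    obtain ⟨i, -, hi⟩ := Finset.exists_lt_of_sum_lt (s := Finset.univ) (f := fun _ => (0 : ℝ))
      (by simpa using hsum)
    exact ⟨i, h.lam_pos_of_budget_pos (hun i) hi⟩
  obtain ⟨i₀, hi₀⟩ := hsome
  have hpos : ∀ i, 0 < lam i := fun i => by
    have : active (Sum.inl i) := by
      refine Relation.ReflTransGen.head_induction_on (motive := fun a _ => active a)
        (hsc i i₀) hi₀ ?_
      exact fun hab _ hb => hedge _ _ hab hb
    exact this
  have hZe : Z = ∅ := h.not_satiated hdem hc1 hc hz hZ fun i j hj k hk hu => by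
    refine (h.alloc_hi i j k hk).resolve_right ?_
    rw [(hmemZ j).1 hj, sub_zero, not_le]
    exact mul_pos hu (hpos i)
  have hp : ∀ j, 0 < p j := fun j => (h.p_nonneg j).lt_of_ne' fun e => by
    have := (hmemZ j).2 e
    simp [hZe] at this
  refine ⟨h.p_nonneg, fun f => ⟨h.optimalPlan f, rfl⟩,
    fun i => h.optimalBundle (hpos i) (hun i), fun j => ?_⟩
  have hw : ∑ j, p j * M.excess xF xA j = 0 := by
    rw [M.walras, Finset.sum_eq_zero fun i _ => hun i, neg_zero]
  have := (Finset.sum_eq_zero_iff_of_nonpos fun j _ =>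
    mul_nonpos_of_nonneg_of_nonpos (h.p_nonneg j) (hz j)).1 hw j (Finset.mem_univ j)
  exact sub_eq_zero.1 ((mul_eq_zero.1 this).resolve_left (hp j).ne')

end IsComplementary

end SPLCMarket

namespace SPLCMarket

variable (M : SPLCMarket)

/-- Coordinates for prices, marginal values of money, production plans and bundles. -/
abbrev Coord : Type :=
  M.G ⊕ M.A ⊕ (Σ f : M.F, Σ j : M.G, Fin (M.numP f j)) ⊕
    (Σ i : M.A, Σ j : M.G, Fin (M.numU i j))

/-- The production plans with given coordinates. -/
def plansOf (v : M.Coord → ℝ) (f : M.F) (j : M.G) (k : ℕ) : ℝ :=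
  if h : k < M.numP f j then v (Sum.inr (Sum.inr (Sum.inl ⟨f, j, k, h⟩))) else 0

/-- The segment-indexed bundles with given coordinates. -/
def allocsOf (v : M.Coord → ℝ) (i : M.A) (j : M.G) (k : ℕ) : ℝ :=
  if h : k < M.numU i j then v (Sum.inr (Sum.inr (Sum.inr ⟨i, j, k, h⟩))) else 0

theorem continuous_plansOf (f : M.F) (j : M.G) (k : ℕ) :
    Continuous fun v => M.plansOf v f j k := by
  unfold plansOf
  split_ifs <;> fun_prop

theorem continuous_allocsOf (i : M.A) (j : M.G) (k : ℕ) :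
    Continuous fun v => M.allocsOf v i j k := by
  unfold allocsOf
  split_ifs <;> fun_prop

/-- The upper bounds of the coordinates. -/
def upper (Λ : ℝ) (c : M.G → ℝ) : M.Coord → ℝ
  | Sum.inl j => c j
  | Sum.inr (Sum.inl _) => Λ
  | Sum.inr (Sum.inr (Sum.inl ⟨f, j, k⟩)) => M.o f j k
  | Sum.inr (Sum.inr (Sum.inr ⟨i, j, k⟩)) => M.l i j k

/-- The field whose complementarity problem describes the equilibria of the market. -/
def field : M.Coord → (M.Coord → ℝ) → ℝ
  | Sum.inl j, v => M.excess (M.plansOf v) (M.allocsOf v) j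
  | Sum.inr (Sum.inl i), v =>
    M.unspent (fun j => v (Sum.inl j)) (M.plansOf v) (M.allocsOf v) i
  | Sum.inr (Sum.inr (Sum.inl ⟨f, j, k⟩)), v =>
    M.α f j k * v (Sum.inl (M.jf f)) - v (Sum.inl j)
  | Sum.inr (Sum.inr (Sum.inr ⟨i, j, k⟩)), v =>
    M.u i j k * v (Sum.inr (Sum.inl i)) - v (Sum.inl j)

theorem continuous_field (s : M.Coord) : Continuous (M.field s) := by
  have hF := M.continuous_plansOf
  have hA := M.continuous_allocsOf
  have hO : ∀ f, Continuous fun v => M.planOutput f (M.plansOf v f) := fun f => by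
    unfold planOutput
    fun_prop
  rcases s with j | i | ⟨f, j, k⟩ | ⟨i, j, k⟩
  · change Continuous fun v => M.excess (M.plansOf v) (M.allocsOf v) j
    unfold excess
    refine Continuous.sub (by fun_prop) (continuous_const.add (continuous_finsetSum _ fun f _ => ?_))
    split_ifs
    · exact hO f
    · exact continuous_const
  · change Continuous fun v =>
      M.unspent (fun j => v (Sum.inl j)) (M.plansOf v) (M.allocsOf v) i
    unfold unspent budget bundleCost planProfit
    fun_prop
  · change Continuous fun v : M.Coord → ℝ => M.α f j k * v (Sum.inl (M.jf f)) - v (Sum.inl j)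
    fun_prop
  · change Continuous fun v : M.Coord → ℝ =>
      M.u i j k * v (Sum.inr (Sum.inl i)) - v (Sum.inl j)
    fun_prop

theorem exists_isComplementary [Nonempty M.G] {Λ : ℝ} (hΛ : 0 ≤ Λ) {c : M.G → ℝ}
    (hc : ∀ j, 0 < c j) : ∃ p xF xA lam, M.IsComplementary Λ p xF xA lam ∧
      (∀ j, p j ≤ c j) ∧ (∃ j, 0 < p j) ∧ ∀ j, M.excess xF xA j ≤ 0 := by
  have hb : 0 ≤ M.upper Λ c := by
    rintro (j | i | ⟨f, j, k⟩ | ⟨i, j, k⟩)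
    · exact (hc j).le
    · exact hΛ
    · exact (M.o_pos f j k k.2).le
    · exact (M.l_pos i j k k.2).le
  obtain ⟨v, hv, ⟨_, ⟨j₀, rfl⟩, hj₀⟩, hcomp, hprice⟩ :=
    exists_box_complementarity_pos (M.upper Λ c) hb (Set.range Sum.inl)
      (Set.range_nonempty _) (by rintro _ ⟨j, rfl⟩; exact hc j) M.field M.continuous_field
  have hF : ∀ f j k (hk : k < M.numP f j),
      M.plansOf v f j k = v (Sum.inr (Sum.inr (Sum.inl ⟨f, j, k, hk⟩))) := fun f j k hk =>
    dif_pos hk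
  have hA : ∀ i j k (hk : k < M.numU i j),
      M.allocsOf v i j k = v (Sum.inr (Sum.inr (Sum.inr ⟨i, j, k, hk⟩))) := fun i j k hk =>
    dif_pos hk
  have h : M.IsComplementary Λ (fun j => v (Sum.inl j)) (M.plansOf v) (M.allocsOf v)
      (fun i => v (Sum.inr (Sum.inl i))) :=
    { p_nonneg := fun j => hv.1 _
      plan := fun f j k => by
        by_cases hk : k < M.numP f j
        · rw [hF f j k hk]
          exact ⟨hv.1 _, fun _ => hv.2 _, fun hk' => absurd hk hk'.not_gt⟩
        · have e : M.plansOf v f j k = 0 := dif_neg hk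
          exact ⟨e.ge, fun hk' => absurd hk' hk, fun _ => e⟩
      plan_lo := fun f j k hk => by
        rw [hF f j k hk]
        exact (hcomp (Sum.inr (Sum.inr (Sum.inl ⟨f, j, k, hk⟩))) (by simp)).1
      plan_hi := fun f j k hk => by
        rw [hF f j k hk]
        exact (hcomp (Sum.inr (Sum.inr (Sum.inl ⟨f, j, k, hk⟩))) (by simp)).2
      alloc := fun i j k => by
        by_cases hk : k < M.numU i j
        · rw [hA i j k hk]
          exact ⟨hv.1 _, fun _ => hv.2 _, fun hk' => absurd hk hk'.not_gt⟩
        · have e : M.allocsOf v i j k = 0 := dif_neg hk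
          exact ⟨e.ge, fun hk' => absurd hk' hk, fun _ => e⟩
      alloc_lo := fun i j k hk => by
        rw [hA i j k hk]
        exact (hcomp (Sum.inr (Sum.inr (Sum.inr ⟨i, j, k, hk⟩))) (by simp)).1
      alloc_hi := fun i j k hk => by
        rw [hA i j k hk]
        exact (hcomp (Sum.inr (Sum.inr (Sum.inr ⟨i, j, k, hk⟩))) (by simp)).2
      lam_nonneg := fun i => hv.1 _
      lam_le := fun i => hv.2 _
      lam_lo := fun i => (hcomp (Sum.inr (Sum.inl i)) (by simp)).1
      lam_hi := fun i => (hcomp (Sum.inr (Sum.inl i)) (by simp)).2 }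
  refine ⟨_, _, _, _, h, fun j => hv.2 _, ⟨j₀, hj₀⟩, ?_⟩
  rcases hprice with hz | hz
  · exact fun j => hz (Sum.inl j) ⟨j, rfl⟩
  have hz : ∀ j, (v (Sum.inl j) = 0 ∨ 0 ≤ M.excess (M.plansOf v) (M.allocsOf v) j) ∧
      (v (Sum.inl j) = c j ∨ M.excess (M.plansOf v) (M.allocsOf v) j ≤ 0) := fun j =>
    hz (Sum.inl j) ⟨j, rfl⟩
  have hnonneg : ∀ j ∈ Finset.univ,
      0 ≤ v (Sum.inl j) * M.excess (M.plansOf v) (M.allocsOf v) j := fun j _ => by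
    rcases (hz j).1 with e | e
    · rw [e, zero_mul]
    · exact mul_nonneg (h.p_nonneg j) e
  have hsum : ∑ j, v (Sum.inl j) * M.excess (M.plansOf v) (M.allocsOf v) j ≤ 0 := by
    rw [M.walras (fun j => v (Sum.inl j)), neg_nonpos]
    exact Finset.sum_nonneg fun i _ => h.unspent_nonneg i
  have hzero := (Finset.sum_eq_zero_iff_of_nonneg hnonneg).1
    (le_antisymm hsum (Finset.sum_nonneg hnonneg))
  intro j
  refine (hz j).2.elim (fun e => ?_) id
  have := hzero j (Finset.mem_univ j)
  rw [e] at this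
  exact ((mul_eq_zero.1 this).resolve_left (hc j).ne').le

/-- The total price of the goods at bounded unprofitable prices is within the safe bounds. -/
theorem sum_prices_bounds [Nonempty M.G] {c : M.G → ℝ}
    (hc : ∀ j, c j ≤ (M.αmax + 1) ^ (Fintype.card M.G - 1)) :
    ∑ j, c j ≤ M.Lbig ∧
      ∀ f j, 0 < M.α f j (M.numP f j - 1) → ∑ j, c j < M.Lbig / max 1 M.αminpos := by
  obtain ⟨m, hm⟩ : ∃ m, Fintype.card M.G = m + 1 :=
    Nat.exists_eq_succ_of_ne_zero Fintype.card_ne_zero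
  have h0 := M.αmax_nonneg
  have hpow : 1 ≤ (M.αmax + 1) ^ m := one_le_pow₀ (by linarith)
  have hn : (1 : ℝ) ≤ (m : ℝ) + 1 := by linarith [m.cast_nonneg (α := ℝ)]
  have hsum : ∑ j, c j ≤ (m + 1) * (M.αmax + 1) ^ m := by
    have := Finset.sum_le_card_nsmul Finset.univ c _ fun j _ => hc j
    simpa [hm] using this
  have hL : (m + 1) * (M.αmax + 1) ^ m * (M.αmax + 1) ≤ M.Lbig := by
    rw [Lbig, hm, pow_succ (M.αmax + 1), ← mul_assoc]
    push_cast
    gcongr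
    exact le_self_pow₀ hn (by omega)
  have hpos : 0 < ((m : ℝ) + 1) * (M.αmax + 1) ^ m := by positivity
  refine ⟨hsum.trans ((le_mul_of_one_le_right hpos.le (by linarith)).trans hL),
    fun f j hα => ?_⟩
  have hk : M.numP f j - 1 < M.numP f j := Nat.sub_lt (M.numP_pos f j) one_pos
  have hmax : max 1 M.αminpos < M.αmax + 1 := by
    have h1 := M.α_le_αmax hk
    have h2 := M.αminpos_le hk hα
    exact max_lt (by linarith) (by linarith)
  rw [lt_div_iff₀ (by positivity)]
  calc (∑ j, c j) * max 1 M.αminpos ≤ (m + 1) * (M.αmax + 1) ^ m * max 1 M.αminpos := by gcongr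
    _ < (m + 1) * (M.αmax + 1) ^ m * (M.αmax + 1) := by gcongr
    _ ≤ M.Lbig := hL

/-- A bound on the marginal value of money at prices at most `c`. -/
theorem exists_lt_mul {c : M.G → ℝ} (hc : ∀ j, 0 < c j) :
    ∃ Λ, 0 ≤ Λ ∧ ∀ i j k, k < M.numU i j → 0 < M.u i j k → c j < M.u i j k * Λ := by
  have hnn : ∀ i j, ∀ k ∈ Finset.range (M.numU i j), 0 ≤ c j / M.u i j k := fun i j k hk =>
    div_nonneg (hc j).le (M.u_nonneg i j k (Finset.mem_range.1 hk))
  have hnn' : ∀ i j, 0 ≤ ∑ k ∈ Finset.range (M.numU i j), c j / M.u i j k := fun i j =>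
    Finset.sum_nonneg (hnn i j)
  have hnn'' : ∀ i, 0 ≤ ∑ j, ∑ k ∈ Finset.range (M.numU i j), c j / M.u i j k := fun i =>
    Finset.sum_nonneg fun j _ => hnn' i j
  refine ⟨1 + ∑ i, ∑ j, ∑ k ∈ Finset.range (M.numU i j), c j / M.u i j k,
    add_nonneg zero_le_one (Finset.sum_nonneg fun i _ => hnn'' i), fun i j k hk hu => ?_⟩
  have h1 := Finset.single_le_sum (hnn i j) (Finset.mem_range.2 hk)
  have h2 := Finset.single_le_sum (fun j _ => hnn' i j) (Finset.mem_univ j)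
  have h3 := Finset.single_le_sum (fun i _ => hnn'' i) (Finset.mem_univ i)
  rw [mul_comm, ← div_lt_iff₀ hu]
  linarith

end SPLCMarket

/-- If the SPLC market `M` satisfies strong connectivity, no production out of nothing,
and enough demand, then `M` admits a market equilibrium. -/
theorem stmt16 (M : SPLCMarket) (hsafe : M.SafeLengths)
    (hsc : M.StrongConnectivity) (hnp : M.NoProductionOutOfNothing)
    (hdem : M.EnoughDemand) :
    ∃ (p : M.G → ℝ) (xF : M.F → M.G → ℕ → ℝ) (xA : M.A → M.G → ℕ → ℝ) (E : M.F → ℝ),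
      M.IsEquilibrium p xF xA E := by
  rcases isEmpty_or_nonempty M.G with hG | hG
  · have hF : IsEmpty M.F := ⟨fun f => hG.elim (M.jf f)⟩
    refine ⟨0, 0, 0, 0, fun j => le_rfl, fun f => hF.elim f, fun i => ⟨fun j => hG.elim j, ?_, ?_⟩,
      fun j => hG.elim j⟩
    · simp [SPLCMarket.bundleCost, SPLCMarket.budget]
    · intro y _ _
      simp [SPLCMarket.utilFn, SPLCMarket.segUtility]
  · obtain ⟨c, hc1, hcle, hc⟩ := M.exists_unprofitable_prices hnp
    have hc0 : ∀ j, 0 < c j := fun j => one_pos.trans_le (hc1 j)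
    obtain ⟨hcL, hcF⟩ := M.sum_prices_bounds hcle
    obtain ⟨Λ, hΛ, hΛu⟩ := M.exists_lt_mul hc0
    obtain ⟨p, xF, xA, lam, h, hpc, hp, hz⟩ := M.exists_isComplementary hΛ hc0
    exact ⟨p, xF, xA, _, h.isEquilibrium hsafe hsc hdem hc1 hc hcL hcF
      (fun i j k hk hu => (hpc j).trans_lt (hΛu i j k hk hu)) hz hp⟩
end
end
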